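/- Let $K$ be a field and let $A$ be a finitely generated $K$-algebra that is a domain with Gelfand–Kirillov dimension strictly less than $3$, and let $Q(A)$ be its quotient division algebra. If $D$ is a division subalgebra of $Q(A)$ with $\mathrm{GKdim}(D) \ge 2$, then $Q(A)$ is finite-dimensional as a left $D$-vector space. -/

import Mathlib

open Filter

/-- The GK growth exponent `limsup_n log(dim V^n)/log n` (in `EReal`) of a
finite-dimensional subspace `V` of a `K`-algebra. -/
noncomputable def gkWrt (K : Type*) {Q : Type*} [Field K] [Ring Q] [Algebra K Q]
    (V : Submodule K Q) : EReal :=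
  Filter.limsup
    (fun n : ℕ => ((Real.log (Module.finrank K ↥(V ^ n)) / Real.log n : ℝ) : EReal)) atTop

/-- The GK dimension of a subset `D` of a `K`-algebra `Q`: the supremum of GK growth
exponents over finite-dimensional subspaces `V ⊆ D` with `1 ∈ V`. -/
noncomputable def gkOfSet (K : Type*) {Q : Type*} [Field K] [Ring Q] [Algebra K Q]
    (D : Set Q) : EReal :=
  sSup { x : EReal | ∃ V : Submodule K Q, FiniteDimensional K ↥V ∧ (1 : Q) ∈ V ∧
    (V : Set Q) ⊆ D ∧ x = gkWrt K V }

set_option linter.unusedSectionVars false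

section PartA
variable {k : Type*} [Field k] {M : Type*} [AddCommGroup M] [Module k M]
  {M' : Type*} [AddCommGroup M'] [Module k M'] {ι : Type*}

/-- neighbourhood of a subspace under a family of operators -/
def nb (φ : ι → Module.End k M) (U : Submodule k M) : Submodule k M :=
  U ⊔ ⨆ i, U.map (φ i)

/-- boundary size -/
noncomputable def bd (φ : ι → Module.End k M) (U : Submodule k M) : ℕ :=
  Module.finrank k (nb φ U) - Module.finrank k U

lemma le_nb (φ : ι → Module.End k M) (U : Submodule k M) : U ≤ nb φ U := le_sup_left

lemma map_le_nb (φ : ι → Module.End k M) (U : Submodule k M) (i : ι) : U.map (φ i) ≤ nb φ U :=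
  le_trans (le_iSup (fun i => U.map (φ i)) i) le_sup_right

lemma nb_le {φ : ι → Module.End k M} {U E : Submodule k M} (h1 : U ≤ E)
    (h2 : ∀ i, ∀ x ∈ U, φ i x ∈ E) : nb φ U ≤ E := by
  refine sup_le h1 (iSup_le fun i => ?_)
  rintro _ ⟨x, hx, rfl⟩
  exact h2 i x hx

lemma nb_mono {φ : ι → Module.End k M} {U E : Submodule k M} (h1 : U ≤ E) : nb φ U ≤ nb φ E :=
  nb_le (h1.trans (le_nb _ _)) fun i x hx => map_le_nb φ E i ⟨x, h1 hx, rfl⟩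

lemma mem_nb (φ : ι → Module.End k M) {U : Submodule k M} (i : ι) {x : M} (hx : x ∈ U) :
    φ i x ∈ nb φ U := map_le_nb φ U i ⟨x, hx, rfl⟩

lemma nb_sup (φ : ι → Module.End k M) (A B : Submodule k M) : nb φ (A ⊔ B) = nb φ A ⊔ nb φ B := by
  apply le_antisymm
  · refine nb_le (sup_le_sup (le_nb _ _) (le_nb _ _)) fun i x hx => ?_
    obtain ⟨a, ha, b, hb, rfl⟩ := Submodule.mem_sup.1 hx
    rw [map_add]
    exact Submodule.add_mem_sup (mem_nb φ i ha) (mem_nb φ i hb)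
  · exact sup_le (nb_mono le_sup_left) (nb_mono le_sup_right)

lemma nb_map {φ : ι → Module.End k M} {ψ : ι → Module.End k M'} (g : M →ₗ[k] M')
    (hg : ∀ i x, g (φ i x) = ψ i (g x)) (U : Submodule k M) :
    nb ψ (U.map g) = (nb φ U).map g := by
  apply le_antisymm
  · refine nb_le (Submodule.map_mono (le_nb _ _)) fun i x hx => ?_
    obtain ⟨u, hu, rfl⟩ := hx
    exact ⟨φ i u, mem_nb φ i hu, hg i u⟩
  · rw [Submodule.map_le_iff_le_comap]
    refine nb_le ?_ fun i x hx => ?_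
    · rw [← Submodule.map_le_iff_le_comap]; exact le_nb _ _
    · rw [Submodule.mem_comap, hg]
      exact mem_nb ψ i ⟨x, hx, rfl⟩

variable [Finite ι]

instance nb_fd (φ : ι → Module.End k M) (U : Submodule k M) [FiniteDimensional k U] :
    FiniteDimensional k (nb φ U) := by
  unfold nb; infer_instance

lemma bd_add (φ : ι → Module.End k M) (U : Submodule k M) [FiniteDimensional k U] :
    bd φ U + Module.finrank k U = Module.finrank k (nb φ U) :=
  Nat.sub_add_cancel (Submodule.finrank_mono (le_nb φ U))

lemma bd_submod (φ : ι → Module.End k M) (A B : Submodule k M) [FiniteDimensional k A]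
    [FiniteDimensional k B] : bd φ (A ⊔ B) + bd φ (A ⊓ B) ≤ bd φ A + bd φ B := by
  have h1 := bd_add φ A
  have h2 := bd_add φ B
  have h3 := bd_add φ (A ⊔ B)
  have : FiniteDimensional k ↥(A ⊓ B) := Submodule.finiteDimensional_inf_left _ _
  have h4 := bd_add φ (A ⊓ B)
  have h5 := Submodule.finrank_sup_add_finrank_inf_eq A B
  have h6 := Submodule.finrank_sup_add_finrank_inf_eq (nb φ A) (nb φ B)
  rw [nb_sup] at h3
  have : FiniteDimensional k ↥(nb φ A ⊓ nb φ B) := Submodule.finiteDimensional_inf_left _ _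
  have h7 := Submodule.finrank_mono (le_inf (nb_mono (φ := φ) (inf_le_left : A ⊓ B ≤ A))
    (nb_mono (φ := φ) (inf_le_right : A ⊓ B ≤ B)))
  omega

lemma bd_inf_stable (φ : ι → Module.End k M) (X E : Submodule k M) [FiniteDimensional k X]
    (hE : ∀ i, ∀ x ∈ E, φ i x ∈ E) : bd φ (X ⊓ E) ≤ bd φ X := by
  have : FiniteDimensional k ↥(X ⊓ E) := Submodule.finiteDimensional_inf_left _ _
  have h1 := bd_add φ X
  have h2 := bd_add φ (X ⊓ E)
  have h3 := Submodule.finrank_sup_add_finrank_inf_eq (nb φ (X ⊓ E)) X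
  have h4 : nb φ (X ⊓ E) ≤ E := nb_le inf_le_right fun i x hx => hE i x hx.2
  have h5 : nb φ (X ⊓ E) ⊓ X = X ⊓ E :=
    le_antisymm (le_inf inf_le_right (inf_le_left.trans h4)) (le_inf (le_nb _ _) inf_le_left)
  have h6 := Submodule.finrank_mono (sup_le (nb_mono (φ := φ) (inf_le_left : X ⊓ E ≤ X))
    (le_nb φ X))
  rw [h5] at h3
  omega

lemma finrank_map_inj (g : M →ₗ[k] M') (hg : Function.Injective g) (U : Submodule k M) :
    Module.finrank k (U.map g) = Module.finrank k U :=
  (LinearEquiv.finrank_eq (Submodule.equivMapOfInjective g hg U)).symm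

lemma bd_map {φ : ι → Module.End k M} {ψ : ι → Module.End k M'} (g : M →ₗ[k] M')
    (hg : ∀ i x, g (φ i x) = ψ i (g x)) (hi : Function.Injective g) (U : Submodule k M) :
    bd ψ (U.map g) = bd φ U := by
  unfold bd
  rw [nb_map g hg, finrank_map_inj g hi, finrank_map_inj g hi]

lemma bd_comap {φ : ι → Module.End k M} {ψ : ι → Module.End k M'} (g : M →ₗ[k] M')
    (hg : ∀ i x, g (φ i x) = ψ i (g x)) (hi : Function.Injective g) (V : Submodule k M')
    [FiniteDimensional k V] : bd φ (V.comap g) ≤ bd ψ V := by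
  rw [← bd_map g hg hi, Submodule.map_comap_eq, inf_comm]
  refine bd_inf_stable ψ V _ ?_
  rintro i _ ⟨x, rfl⟩
  exact ⟨φ i x, hg i x⟩

lemma fd_comap (g : M →ₗ[k] M') (hi : Function.Injective g) (V : Submodule k M')
    [FiniteDimensional k V] : FiniteDimensional k (V.comap g) := by
  have : FiniteDimensional k ((V.comap g).map g) := 
    Submodule.finiteDimensional_of_le (Submodule.map_comap_le g V)
  exact Module.Finite.equiv (Submodule.equivMapOfInjective g hi _).symm

lemma finrank_map_add_ker (g : M →ₗ[k] M') (X : Submodule k M) [FiniteDimensional k X] :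
    Module.finrank k (X.map g) + Module.finrank k ↥(X ⊓ LinearMap.ker g) = Module.finrank k X := by
  have h := LinearMap.finrank_range_add_finrank_ker (g.domRestrict X)
  rw [LinearMap.range_domRestrict] at h
  rw [← h]
  congr 1
  rw [LinearMap.ker_domRestrict]
  rw [← finrank_map_inj X.subtype X.subtype_injective, Submodule.map_comap_subtype]

lemma bd_ker_map {φ : ι → Module.End k M} {ψ : ι → Module.End k M'} (g : M →ₗ[k] M')
    (hg : ∀ i x, g (φ i x) = ψ i (g x)) (X : Submodule k M) [FiniteDimensional k X] :
    bd φ (X ⊓ LinearMap.ker g) + bd ψ (X.map g) ≤ bd φ X := by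
  have : FiniteDimensional k ↥(X ⊓ LinearMap.ker g) := Submodule.finiteDimensional_inf_left _ _
  have h1 := bd_add φ X
  have h2 := bd_add φ (X ⊓ LinearMap.ker g)
  have h3 := bd_add ψ (X.map g)
  rw [nb_map g hg] at h3
  have h4 := finrank_map_add_ker g X
  have h5 := finrank_map_add_ker g (nb φ X)
  have : FiniteDimensional k ↥(nb φ X ⊓ LinearMap.ker g) := Submodule.finiteDimensional_inf_left _ _
  have h6 : nb φ (X ⊓ LinearMap.ker g) ≤ nb φ X ⊓ LinearMap.ker g := by
    refine le_inf (nb_mono inf_le_left) (nb_le inf_le_right fun i x hx => ?_)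
    rw [LinearMap.mem_ker, hg, LinearMap.mem_ker.1 hx.2, map_zero]
  have h7 := Submodule.finrank_mono h6
  omega

/-- every finite dimensional subspace containing `S` has boundary at least `N` -/
def LamGe (φ : ι → Module.End k M) (S : Set M) (N : ℕ) : Prop :=
  ∀ U : Submodule k M, FiniteDimensional k U → S ⊆ U → N ≤ bd φ U

lemma line_pi (φ : ι → Module.End k M) (S : Set M) (N : ℕ) (hS : LamGe φ S N) (m : ℕ) :
    ∀ X : Submodule k (Fin m → M), FiniteDimensional k X →
      (∀ s ∈ S, ∀ a, (Pi.single a s : Fin m → M) ∈ X) →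
      m * N ≤ bd (fun i => (φ i).compLeft (Fin m)) X := by
  induction m with
  | zero => intro X _ _; simp
  | succ m ih =>
    intro X hX hs
    have h1 := bd_ker_map (φ := fun i => (φ i).compLeft (Fin (m+1))) (ψ := φ)
      (LinearMap.proj 0) (by intro i x; rfl) X
    have h2 : N ≤ bd φ (X.map (LinearMap.proj 0)) := by
      refine hS _ inferInstance fun s hs' => ⟨_, hs s hs' 0, by simp⟩
    have : FiniteDimensional k ↥(X ⊓ LinearMap.ker (LinearMap.proj (R := k) (φ := fun _ : Fin (m+1) => M) 0)) :=
      Submodule.finiteDimensional_inf_left _ _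
    let g : (Fin m → M) →ₗ[k] (Fin (m+1) → M) :=
      { toFun := fun f => Fin.cons 0 f
        map_add' := by intro x y; ext i; refine Fin.cases ?_ (fun j => ?_) i <;> simp
        map_smul' := by intro c y; ext i; refine Fin.cases ?_ (fun j => ?_) i <;> simp }
    have gi : Function.Injective g := fun x y h => funext fun j => by simpa [g] using congrFun h j.succ
    have hg : ∀ i x, g ((φ i).compLeft (Fin m) x) = (φ i).compLeft (Fin (m+1)) (g x) := by
      intro i x; ext j; refine Fin.cases ?_ (fun j => ?_) j <;> simp [g]
    have h3 := bd_comap (φ := fun i => (φ i).compLeft (Fin m))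
      (ψ := fun i => (φ i).compLeft (Fin (m+1))) g hg gi
      (X ⊓ LinearMap.ker (LinearMap.proj (R := k) (φ := fun _ : Fin (m+1) => M) 0))
    have h4 := ih _ (fd_comap g gi
      (X ⊓ LinearMap.ker (LinearMap.proj (R := k) (φ := fun _ : Fin (m+1) => M) 0))) ?_
    · rw [add_mul, one_mul]; omega
    · intro s hs' a
      have : g (Pi.single a s) = Pi.single a.succ s := by
        ext j; refine Fin.cases ?_ (fun j => ?_) j
        · simp [g]
        · by_cases h : j = a
          · subst h; simp [g]
          · simp [g, h]
      rw [Submodule.mem_comap, this]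
      exact ⟨hs s hs' _, by simp⟩

theorem line_lemma {φ : ι → Module.End k M} {ψ : ι → Module.End k M'} {m : ℕ}
    (f : Fin m → M →ₗ[k] M') (hf : ∀ a i x, f a (φ i x) = ψ i (f a x))
    (hinj : ∀ d : Fin m → M, ∑ a, f a (d a) = 0 → d = 0)
    {S : Set M} {N : ℕ} (hS : LamGe φ S N) (X : Submodule k M') [FiniteDimensional k X]
    (hX : ∀ s ∈ S, ∀ a, f a s ∈ X) : m * N ≤ bd ψ X := by
  let g : (Fin m → M) →ₗ[k] M' := LinearMap.lsum k (fun _ => M) k f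
  have ga : ∀ d, g d = ∑ a, f a (d a) := by intro d; simp [g]
  have gi : Function.Injective g := by
    rw [← LinearMap.ker_eq_bot, LinearMap.ker_eq_bot']
    intro d hd; exact hinj d (by rw [← ga, hd])
  have hg : ∀ i x, g ((φ i).compLeft (Fin m) x) = ψ i (g x) := by
    intro i x; simp [ga, hf]
  refine le_trans ?_ (bd_comap (φ := fun i => (φ i).compLeft (Fin m)) g hg gi X)
  refine line_pi φ S N hS m _ (fd_comap g gi X) fun s hs a => ?_
  rw [Submodule.mem_comap, ga, Finset.sum_eq_single a]
  · simpa using hX s hs a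
  · intro b _ hb; simp [hb]
  · simp

end PartA

section PartB
variable {k : Type*} [Field k] {M : Type*} [AddCommGroup M] [Module k M]
  {M' : Type*} [AddCommGroup M'] [Module k M'] {ι : Type*} [Finite ι]

/-- minimal boundary of a finite dimensional subspace containing `S` -/
noncomputable def Lam (φ : ι → Module.End k M) (S : Set M) : ℕ :=
  sInf {n | ∃ U : Submodule k M, FiniteDimensional k U ∧ S ⊆ U ∧ bd φ U = n}

/-- subspaces attaining the minimal boundary -/
def Tight (φ : ι → Module.End k M) (S : Set M) (U : Submodule k M) : Prop :=
  FiniteDimensional k U ∧ S ⊆ U ∧ bd φ U = Lam φ S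

/-- points in a tight subspace -/
def InCl (φ : ι → Module.End k M) (S : Set M) (x : M) : Prop := ∃ U, Tight φ S U ∧ x ∈ U

lemma Lam_le {φ : ι → Module.End k M} {S : Set M} (U : Submodule k M) [h : FiniteDimensional k U]
    (hS : S ⊆ U) : Lam φ S ≤ bd φ U := Nat.sInf_le ⟨U, h, hS, rfl⟩

lemma exists_tight (φ : ι → Module.End k M) {S : Set M} (hS : S.Finite) : ∃ U, Tight φ S U := by
  have : {n | ∃ U : Submodule k M, FiniteDimensional k U ∧ S ⊆ U ∧ bd φ U = n}.Nonempty :=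
    ⟨_, Submodule.span k S, FiniteDimensional.span_of_finite k hS, Submodule.subset_span, rfl⟩
  exact Nat.sInf_mem this

lemma Lam_mono {φ : ι → Module.End k M} {S T : Set M} (hT : T.Finite) (h : S ⊆ T) :
    Lam φ S ≤ Lam φ T := by
  obtain ⟨U, hU, hs, he⟩ := exists_tight φ hT
  rw [← he]; exact Lam_le U (h.trans hs)

lemma Tight.sup_tight {φ : ι → Module.End k M} {S T : Set M} {A B : Submodule k M}
    (hA : Tight φ S A) (hB : Tight φ T B) (h : S ⊆ T) : Tight φ T (A ⊔ B) := by
  obtain ⟨fA, sA, eA⟩ := hA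
  obtain ⟨fB, sB, eB⟩ := hB
  have h1 := bd_submod φ A B
  have : FiniteDimensional k ↥(A ⊓ B) := Submodule.finiteDimensional_inf_left _ _
  have h2 : Lam φ S ≤ bd φ (A ⊓ B) := Lam_le _ (fun x hx => ⟨sA hx, sB (h hx)⟩)
  have h3 : T ⊆ ↑(A ⊔ B) := fun x hx => (le_sup_right : B ≤ A ⊔ B) (sB hx)
  have h4 : Lam φ T ≤ bd φ (A ⊔ B) := Lam_le _ h3
  exact ⟨inferInstance, h3, by omega⟩

lemma Tight.inf_tight {φ : ι → Module.End k M} {S : Set M} {A B : Submodule k M}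
    (hA : Tight φ S A) (hB : Tight φ S B) : Tight φ S (A ⊓ B) := by
  obtain ⟨fA, sA, eA⟩ := hA
  obtain ⟨fB, sB, eB⟩ := hB
  have h1 := bd_submod φ A B
  have : FiniteDimensional k ↥(A ⊓ B) := Submodule.finiteDimensional_inf_left _ _
  have h3 : S ⊆ ↑(A ⊓ B) := fun x hx => ⟨sA hx, sB hx⟩
  have h2 : Lam φ S ≤ bd φ (A ⊓ B) := Lam_le _ h3
  have h4 : Lam φ S ≤ bd φ (A ⊔ B) := Lam_le _ (fun x hx => (le_sup_right : B ≤ A ⊔ B) (sB hx))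
  exact ⟨inferInstance, h3, by omega⟩

lemma InCl.mono_set {φ : ι → Module.End k M} {S T : Set M} {x : M} (hx : InCl φ S x)
    (hT : T.Finite) (h : S ⊆ T) : InCl φ T x := by
  obtain ⟨A, hA, hxA⟩ := hx
  obtain ⟨B, hB⟩ := exists_tight φ hT
  exact ⟨A ⊔ B, hA.sup_tight hB h, (le_sup_left : A ≤ A ⊔ B) hxA⟩

lemma InCl.add_mem {φ : ι → Module.End k M} {S : Set M} {x y : M} (hx : InCl φ S x)
    (hy : InCl φ S y) : InCl φ S (x + y) := by
  obtain ⟨A, hA, hxA⟩ := hx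
  obtain ⟨B, hB, hyB⟩ := hy
  exact ⟨A ⊔ B, hA.sup_tight hB subset_rfl, Submodule.add_mem_sup hxA hyB⟩

lemma InCl.smul_mem {φ : ι → Module.End k M} {S : Set M} {x : M} (hx : InCl φ S x) (c : k) :
    InCl φ S (c • x) := by
  obtain ⟨A, hA, hxA⟩ := hx
  exact ⟨A, hA, A.smul_mem c hxA⟩

lemma InCl.sub_mem {φ : ι → Module.End k M} {S : Set M} {x y : M} (hx : InCl φ S x)
    (hy : InCl φ S y) : InCl φ S (x - y) := by
  have := hx.add_mem (hy.smul_mem (-1))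
  simpa [sub_eq_add_neg] using this

lemma InCl.sum_mem {φ : ι → Module.End k M} {S : Set M} (hS : S.Finite) {κ : Type*} (s : Finset κ)
    (x : κ → M) (hx : ∀ i ∈ s, InCl φ S (x i)) : InCl φ S (∑ i ∈ s, x i) := by
  classical
  induction s using Finset.induction_on with
  | empty =>
    obtain ⟨A, hA⟩ := exists_tight φ hS
    exact ⟨A, hA, by simp⟩
  | insert a s ha ih =>
    rw [Finset.sum_insert ha]
    exact (hx a (Finset.mem_insert_self _ _)).add_mem
      (ih fun i hi => hx i (Finset.mem_insert_of_mem hi))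

lemma InCl.exists_of_finite {φ : ι → Module.End k M} {S F : Set M} (hS : S.Finite) (hF : F.Finite)
    (h : ∀ x ∈ F, InCl φ S x) : ∃ U, Tight φ S U ∧ F ⊆ U := by
  induction F, hF using Set.Finite.induction_on with
  | empty =>
    obtain ⟨A, hA⟩ := exists_tight φ hS
    exact ⟨A, hA, by simp⟩
  | @insert a s ha _ ih =>
    obtain ⟨B, hB, hsB⟩ := ih fun x hx => h x (Set.mem_insert_of_mem _ hx)
    obtain ⟨A, hA, hxA⟩ := h a (Set.mem_insert _ _)
    refine ⟨A ⊔ B, hA.sup_tight hB subset_rfl, ?_⟩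
    rintro x (rfl | hx)
    · exact (le_sup_left : A ≤ A ⊔ B) hxA
    · exact (le_sup_right : B ≤ A ⊔ B) (hsB hx)

/-- image under a linear injective equivariant map -/
lemma InCl.map_linear {φ : ι → Module.End k M} {ψ : ι → Module.End k M'} (g : M →ₗ[k] M')
    (hg : ∀ i x, g (φ i x) = ψ i (g x)) (hi : Function.Injective g) {S : Set M} (hS : S.Finite)
    {x : M} (hx : InCl φ S x) : InCl ψ (g '' S) (g x) := by
  obtain ⟨A, ⟨fA, sA, eA⟩, hxA⟩ := hx
  refine ⟨A.map g, ⟨inferInstance, Set.image_mono sA, ?_⟩, ⟨x, hxA, rfl⟩⟩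
  have h1 := Lam_le (φ := ψ) (S := g '' S) (A.map g) (Set.image_mono sA)
  have h2 : Lam φ S ≤ Lam ψ (g '' S) := by
    obtain ⟨U, fU, sU, eU⟩ := exists_tight ψ (hS.image g)
    have := fd_comap g hi U
    rw [← eU]
    refine le_trans (Lam_le (U.comap g) fun s hs => ?_) (bd_comap g hg hi U)
    exact sU ⟨s, hs, rfl⟩
  rw [bd_map g hg hi] at *
  omega

/-- image under a semilinear automorphism -/
def mapE (σ : k ≃+* k) (e : M ≃+ M) (he : ∀ (c : k) x, e (c • x) = σ c • e x)
    (U : Submodule k M) : Submodule k M where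
  carrier := e '' U
  add_mem' := by
    rintro _ _ ⟨x, hx, rfl⟩ ⟨y, hy, rfl⟩
    exact ⟨x + y, U.add_mem hx hy, map_add _ _ _⟩
  zero_mem' := ⟨0, U.zero_mem, map_zero _⟩
  smul_mem' := by
    rintro c _ ⟨x, hx, rfl⟩
    exact ⟨σ.symm c • x, U.smul_mem _ hx, by simp [he]⟩

lemma mem_mapE {σ : k ≃+* k} {e : M ≃+ M} {he : ∀ (c : k) x, e (c • x) = σ c • e x}
    {U : Submodule k M} {x : M} (hx : x ∈ U) : e x ∈ mapE σ e he U := ⟨x, hx, rfl⟩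

/-- the additive equivalence of a subspace with its image -/
noncomputable def mapEEquiv (σ : k ≃+* k) (e : M ≃+ M) (he : ∀ (c : k) x, e (c • x) = σ c • e x)
    (U : Submodule k M) : U ≃+ mapE σ e he U :=
  AddEquiv.ofBijective
    { toFun := fun x => ⟨e x, mem_mapE x.2⟩
      map_zero' := by ext; simp
      map_add' := by intro x y; ext; simp : U →+ mapE σ e he U }
    ⟨fun x y h => by
      have := congrArg Subtype.val h
      exact Subtype.ext (e.injective this), by
      rintro ⟨_, x, hx, rfl⟩
      exact ⟨⟨x, hx⟩, rfl⟩⟩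

lemma rank_mapE (σ : k ≃+* k) (e : M ≃+ M) (he : ∀ (c : k) x, e (c • x) = σ c • e x)
    (U : Submodule k M) : Module.rank k (mapE σ e he U) = Module.rank k U := by
  refine (rank_eq_of_equiv_equiv (σ : k → k) (mapEEquiv σ e he U) σ.bijective ?_).symm
  intro c x
  ext
  exact he c x

lemma fd_mapE (σ : k ≃+* k) (e : M ≃+ M) (he : ∀ (c : k) x, e (c • x) = σ c • e x)
    (U : Submodule k M) [FiniteDimensional k U] : FiniteDimensional k (mapE σ e he U) := by
  have := rank_mapE σ e he U
  rw [FiniteDimensional, ← Module.rank_lt_aleph0_iff, this]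
  exact Module.rank_lt_aleph0 _ _

lemma bd_mapE {φ : ι → Module.End k M} (σ : k ≃+* k) (e : M ≃+ M)
    (he : ∀ (c : k) x, e (c • x) = σ c • e x) (hc : ∀ i x, e (φ i x) = φ i (e x))
    (U : Submodule k M) : bd φ (mapE σ e he U) = bd φ U := by
  have h1 : nb φ (mapE σ e he U) = mapE σ e he (nb φ U) := by
    apply le_antisymm
    · refine nb_le (Set.image_mono (le_nb φ U)) ?_
      rintro i _ ⟨x, hx, rfl⟩
      exact ⟨φ i x, mem_nb φ i hx, hc i x⟩
    · rintro _ ⟨x, hx, rfl⟩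
      have h2 : nb φ U ≤ mapE σ.symm e.symm (fun c x => by
          apply e.injective; simp [he]) (nb φ (mapE σ e he U)) := by
        refine nb_le ?_ ?_
        · intro x hx
          exact ⟨e x, le_nb _ _ (mem_mapE hx), by simp⟩
        · intro i x hx
          exact ⟨φ i (e x), mem_nb _ _ (mem_mapE hx), by rw [← hc]; simp⟩
      obtain ⟨y, hy, rfl⟩ := h2 hx
      simpa using hy
  unfold bd
  rw [h1]
  unfold Module.finrank
  rw [rank_mapE, rank_mapE]

lemma Lam_image_le {φ : ι → Module.End k M} (σ : k ≃+* k) (e : M ≃+ M)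
    (he : ∀ (c : k) x, e (c • x) = σ c • e x) (hc : ∀ i x, e (φ i x) = φ i (e x))
    {S : Set M} (hS : S.Finite) : Lam φ (e '' S) ≤ Lam φ S := by
  obtain ⟨U, fU, sU, eU⟩ := exists_tight φ hS
  have := fd_mapE σ e he U
  rw [← eU, ← bd_mapE σ e he hc]
  exact Lam_le _ (Set.image_mono sU)

lemma InCl.map_semi {φ : ι → Module.End k M} (σ : k ≃+* k) (e : M ≃+ M)
    (he : ∀ (c : k) x, e (c • x) = σ c • e x) (hc : ∀ i x, e (φ i x) = φ i (e x))
    {S : Set M} (hS : S.Finite) {x : M} (hx : InCl φ S x) : InCl φ (e '' S) (e x) := by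
  obtain ⟨A, ⟨fA, sA, eA⟩, hxA⟩ := hx
  refine ⟨mapE σ e he A, ⟨fd_mapE σ e he A, Set.image_mono sA, ?_⟩, ⟨x, hxA, rfl⟩⟩
  have h1 := Lam_image_le (φ := φ) σ e he hc hS
  have h2 := Lam_image_le (φ := φ) σ.symm e.symm (fun c x => by apply e.injective; simp [he])
    (fun i x => by apply e.injective; simp [hc]) (hS.image e)
  rw [← Set.image_comp] at h2
  simp only [AddEquiv.symm_comp_self, Set.image_id] at h2
  rw [bd_mapE σ e he hc, eA]
  omega

end PartB

section Generic
variable {F : Type*} [Field F] {R : Type*} [Ring R] [NoZeroDivisors R] [Nontrivial R] [Algebra F R]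

/-- left multiplications -/
def lm (F : Type*) [Field F] {R : Type*} [Ring R] [Algebra F R] {ι : Type*} (w : ι → R) :
    ι → Module.End F R := fun i => LinearMap.mulLeft F (w i)

variable {r : ℕ} (w : Fin r → R) (t : ℕ → Fin r → F)

/-- generic letter -/
def gv (i : ℕ) : R := ∑ j, t i j • w j

/-- generic words -/
def gq : ℕ → R
  | 0 => 1
  | (i+1) => gv w t (i+1) * gq i

/-- product of the letters `a+n, ..., a+1` -/
def gp (a : ℕ) : ℕ → R
  | 0 => 1
  | (n+1) => gv w t (a+n+1) * gp a n

lemma gp_succ (a n : ℕ) : gp w t a (n+1) = gp w t (a+1) n * gv w t (a+1) := by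
  induction n with
  | zero => simp [gp]
  | succ n ih =>
    rw [gp, ih, gp, mul_assoc]
    congr 2; congr 1; omega

lemma gq_add (a n : ℕ) : gq w t (a+n) = gp w t a n * gq w t a := by
  induction n with
  | zero => simp [gp]
  | succ n ih => rw [← add_assoc, gq, ih, gp, mul_assoc]

/-- automorphism data -/
structure Aut (F R : Type*) [Field F] [Ring R] [Algebra F R] {r : ℕ} (w : Fin r → R) where
  s : F ≃+* F
  e : R ≃+* R
  he : ∀ (c : F) x, e (c • x) = s c • e x
  hw : ∀ j, e (w j) = w j

lemma Aut.cl {w : Fin r → R} (E : Aut F R w) {S : Set R} (hS : S.Finite) {x : R}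
    (hx : InCl (lm F w) S x) : InCl (lm F w) (E.e '' S) (E.e x) :=
  InCl.map_semi E.s E.e.toAddEquiv E.he (by intro i x; simp [lm, E.hw]) hS hx

theorem generic_words
    (θ : Aut F R w) (hθ : ∀ i j, θ.s (t i j) = t (i+1) j)
    (g : ∀ i i' : ℕ, i < i' → ∀ j, ∃ E : Aut F R w, E.s (t i j) = t i j * t i' j ∧
      ∀ i0 j0, (i0 ≠ i ∨ j0 ≠ j) → E.s (t i0 j0) = t i0 j0)
    (ht0 : ∀ i j, t i j ≠ 0) (ht1 : ∀ i j, t i j ≠ 1)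
    (hv : ∀ i, gv w t i ≠ 0)
    (unb : ∀ l : ℕ, ∃ n : ℕ, ∀ U : Submodule F R, FiniteDimensional F U →
      (∀ L : List (Fin r), L.length = n → (L.map w).prod ∈ U) → l < bd (lm F w) U) (k : ℕ) :
    LamGe (lm F w) (gq w t '' Set.Iic k) k := by
  -- behaviour of automorphisms on letters
  have Ev : ∀ (E : Aut F R w) i, (∀ j, E.s (t i j) = t i j) → E.e (gv w t i) = gv w t i := by
    intro E i h; simp [gv, E.he, E.hw, h]
  have Egp : ∀ (E : Aut F R w) a n, (∀ i, a < i → i ≤ a + n → ∀ j, E.s (t i j) = t i j) →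
      E.e (gp w t a n) = gp w t a n := by
    intro E a n
    induction n with
    | zero => intro h; simp [gp]
    | succ n ih =>
      intro h
      rw [gp, map_mul, ih fun i h1 h2 => h i h1 (by omega), Ev E _ (h _ (by omega) (by omega))]
  have Egq : ∀ (E : Aut F R w) n, (∀ i, i ≤ n → ∀ j, E.s (t i j) = t i j) →
      E.e (gq w t n) = gq w t n := by
    intro E n h
    have := gq_add w t 0 n
    rw [zero_add] at this
    rw [this, map_mul, Egp E 0 n fun i h1 h2 => h i (by omega)]
    simp [gq]
  have fin : ∀ k, (gq w t '' Set.Iic k).Finite := fun k => (Set.finite_Iic k).image _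
  have qne : ∀ n, gq w t n ≠ 0 := by
    intro n
    induction n with
    | zero => simp [gq]
    | succ n ih => rw [gq]; exact mul_ne_zero (hv _) ih
  -- peeling off letters
  have peel : ∀ k i n (L : List (Fin r)) j,
      InCl (lm F w) (gq w t '' Set.Iic k) (gp w t (k+i) (n+1) * ((L.map w).prod * gq w t k)) →
      InCl (lm F w) (gq w t '' Set.Iic k) (gp w t (k+(i+1)) n * (((j :: L).map w).prod * gq w t k)) := by
    intro k i n L j h
    obtain ⟨E, E1, E2⟩ := g (k+i+1) (k+i+1+n+1) (by omega) j
    have h1 := E.cl (fin k) h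
    have himg : E.e '' (gq w t '' Set.Iic k) = gq w t '' Set.Iic k := by
      rw [← Set.image_comp]
      refine Set.image_congr fun a ha => ?_
      have ha : a ≤ k := ha
      exact Egq E a fun i hi j => E2 _ _ (Or.inl (by omega))
    rw [himg] at h1
    have hL : E.e (L.map w).prod = (L.map w).prod := by
      rw [map_list_prod, List.map_map]
      congr 2
      funext j; exact E.hw j
    have hgv : E.e (gv w t (k+i+1)) = gv w t (k+i+1) +
        (t (k+i+1) j * (t (k+i+1+n+1) j - 1)) • w j := by
      have : ∀ x, E.s (t (k+i+1) x) • w x = t (k+i+1) x • w x +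
          if x = j then (t (k+i+1) j * (t (k+i+1+n+1) j - 1)) • w j else 0 := by
        intro x
        split_ifs with hx
        · subst hx; rw [E1, ← add_smul]; congr 1; ring
        · rw [E2 _ _ (Or.inr hx), add_zero]
      simp [gv, E.he, E.hw, this, Finset.sum_add_distrib]
    have h2 := h1.sub_mem h
    rw [gp_succ, map_mul, map_mul, map_mul, hL, hgv,
      Egq E k fun i hi j => E2 _ _ (Or.inl (by omega)),
      Egp E (k+i+1) n fun i h1 h2 j => E2 _ _ (Or.inl (by omega)), ← sub_mul, mul_add,
      add_sub_cancel_left] at h2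
    have hc : t (k+i+1) j * (t (k+i+1+n+1) j - 1) ≠ 0 :=
      mul_ne_zero (ht0 _ _) (sub_ne_zero.2 (ht1 _ _))
    have h3 := h2.smul_mem (t (k+i+1) j * (t (k+i+1+n+1) j - 1))⁻¹
    rw [mul_smul_comm, smul_mul_assoc, smul_smul, inv_mul_cancel₀ hc, one_smul] at h3
    simpa [mul_assoc, add_assoc] using h3
  -- main step
  have step : ∀ k, ¬ InCl (lm F w) (gq w t '' Set.Iic k) (gq w t (k+1)) := by
    intro k hk
    have T0 : ∀ j, InCl (lm F w) (gq w t '' Set.Iic k) (w j * gq w t k) := by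
      intro j
      have := peel k 0 0 [] j (by simpa [gp, gq] using hk)
      simpa [gp] using this
    have T : ∀ n j, InCl (lm F w) (gq w t '' Set.Iic (k+n)) (w j * gq w t (k+n)) := by
      intro n
      induction n with
      | zero => exact T0
      | succ n ih =>
        intro j
        have h1 := θ.cl (fin _) (ih j)
        have h2 := h1.map_linear (ψ := lm F w) (LinearMap.mulRight F (gv w t 1))
          (by intro i x; simp [lm, mul_assoc])
          (fun x y hxy => mul_right_cancel₀ (hv 1) hxy) ((fin _).image _)
        have hs : ∀ n, θ.e (gq w t n) * gv w t 1 = gq w t (n+1) := by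
          intro n
          induction n with
          | zero => simp [gq]
          | succ n ih =>
            have : θ.e (gv w t (n+1)) = gv w t (n+2) := by
              simp [gv, θ.he, θ.hw, hθ]
            rw [gq, map_mul, mul_assoc, ih, this]; rfl
        refine InCl.mono_set (S := ?_) ?_ (fin _) ?_
        · exact (LinearMap.mulRight F (gv w t 1)) '' (θ.e '' (gq w t '' Set.Iic (k+n)))
        · convert h2 using 1
          simp [θ.hw, mul_assoc, hs]; exact Or.inl rfl
        · rintro _ ⟨_, ⟨_, ⟨a, ha, rfl⟩, rfl⟩, rfl⟩
          have ha : a ≤ k + n := ha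
          refine ⟨a+1, ?_, ?_⟩
          · show a + 1 ≤ k + (n+1)
            omega
          · simp [hs]
    have Q1 : ∀ n, InCl (lm F w) (gq w t '' Set.Iic (k+n)) (gq w t (k+n+1)) := by
      intro n
      rw [gq, gv, Finset.sum_mul]
      refine InCl.sum_mem (fin _) _ _ fun j _ => ?_
      rw [smul_mul_assoc]
      exact (T n j).smul_mem _
    have LE : ∀ n, Lam (lm F w) (gq w t '' Set.Iic (k+n)) ≤ Lam (lm F w) (gq w t '' Set.Iic k) := by
      intro n
      induction n with
      | zero => exact le_rfl
      | succ n ih =>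
        obtain ⟨U, ⟨fU, sU, eU⟩, hU⟩ := Q1 n
        refine le_trans ?_ ih
        rw [← eU]
        refine Lam_le U ?_
        rintro _ ⟨a, ha, rfl⟩
        have ha : a ≤ k + (n+1) := ha
        rcases Nat.lt_or_ge (k+n) a with h | h
        · have : a = k + n + 1 := by omega
          rw [this]; exact hU
        · exact sU ⟨a, h, rfl⟩
    have Q2 : ∀ n, InCl (lm F w) (gq w t '' Set.Iic k) (gq w t (k+n)) := by
      intro n
      obtain ⟨U, fU, sU, eU⟩ := exists_tight (lm F w) (fin (k+n))
      have hsub : gq w t '' Set.Iic k ⊆ U :=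
        (Set.image_mono (Set.Iic_subset_Iic.2 (by omega))).trans sU
      refine ⟨U, ⟨fU, hsub, ?_⟩, sU ⟨k+n, Set.mem_Iic.2 le_rfl, rfl⟩⟩
      have := LE n
      have := Lam_le (φ := lm F w) U hsub
      omega
    have Wd : ∀ i, ∀ L : List (Fin r), L.length = i → ∀ n,
        InCl (lm F w) (gq w t '' Set.Iic k) (gp w t (k+i) n * ((L.map w).prod * gq w t k)) := by
      intro i
      induction i with
      | zero =>
        intro L hL n
        rw [List.length_eq_zero_iff] at hL
        subst hL
        have := Q2 n
        rw [gq_add] at this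
        simpa using this
      | succ i ih =>
        intro L hL n
        obtain ⟨j, L', rfl⟩ := List.exists_cons_of_length_eq_add_one hL
        exact peel k i n L' j (ih L' (by simpa using hL) (n+1))
    obtain ⟨n, hn⟩ := unb (Lam (lm F w) (gq w t '' Set.Iic k))
    have hfin : {L : List (Fin r) | L.length = n}.Finite := List.finite_length_eq _ _
    obtain ⟨U, ⟨fU, sU, eU⟩, hU⟩ := InCl.exists_of_finite (φ := lm F w) (fin k)
      (hfin.image fun L => (L.map w).prod * gq w t k) (by
        rintro _ ⟨L, hL, rfl⟩
        have := Wd n L hL 0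
        simpa [gp] using this)
    have hinj : Function.Injective (LinearMap.mulRight F (gq w t k)) :=
      fun x y hxy => mul_right_cancel₀ (qne k) hxy
    have h1 := hn (U.comap (LinearMap.mulRight F (gq w t k))) (fd_comap _ hinj U)
      (fun L hL => hU ⟨L, hL, rfl⟩)
    have h2 := bd_comap (φ := lm F w) (ψ := lm F w) (LinearMap.mulRight F (gq w t k))
      (by intro i x; simp [lm, mul_assoc]) hinj U
    omega
  have fin2 : k ≤ Lam (lm F w) (gq w t '' Set.Iic k) := by
    induction k with
    | zero => exact Nat.zero_le _
    | succ k ih =>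
      by_contra hcon
      apply step k
      obtain ⟨U, fU, sU, eU⟩ := exists_tight (lm F w) (fin (k+1))
      have hsub : gq w t '' Set.Iic k ⊆ U :=
        (Set.image_mono (Set.Iic_subset_Iic.2 (by omega))).trans sU
      refine ⟨U, ⟨fU, hsub, ?_⟩, sU ⟨k+1, Set.mem_Iic.2 le_rfl, rfl⟩⟩
      have := Lam_le (φ := lm F w) U hsub
      omega
  intro U fU sU
  exact fin2.trans (Lam_le U sU)

end Generic

section Growth

lemma sum_shift_le (v : ℕ → ℕ) (hv : Monotone v) (M c : ℕ) : ∀ a,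
    ∑ n ∈ Finset.range M, v (a + n + c) ≤ ∑ n ∈ Finset.range M, v (a + n) + c * v (a + M + c) := by
  induction c with
  | zero => intro a; simp
  | succ c ih =>
    intro a
    have h1 := ih (a+1)
    have h2 : ∑ n ∈ Finset.range M, v (a + n + (c+1)) = ∑ n ∈ Finset.range M, v (a + 1 + n + c) :=
      Finset.sum_congr rfl fun n _ => by congr 1; omega
    have h3 : ∑ n ∈ Finset.range M, v (a + 1 + n) ≤ ∑ n ∈ Finset.range M, v (a + n) + v (a + M) := by
      have h4 := Finset.sum_range_succ (fun n => v (a + n)) M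
      have h5 := Finset.sum_range_succ' (fun n => v (a + n)) M
      have h6 : ∑ n ∈ Finset.range M, v (a + 1 + n) = ∑ n ∈ Finset.range M, v (a + (n+1)) :=
        Finset.sum_congr rfl fun n _ => by congr 1; omega
      omega
    have h7 : v (a + M) ≤ v (a + M + (c+1)) := hv (by omega)
    have h8 : a + 1 + M + c = a + M + (c+1) := by omega
    rw [h8] at h1
    rw [h2]
    calc _ ≤ _ := h1
      _ ≤ _ := by rw [add_mul, one_mul]; omega

theorem growth_contra (v s : ℕ → ℕ) (hv : Monotone v) (hv1 : ∀ n, 1 ≤ v n) (r c : ℕ)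
    (H1 : ∀ n, (n + 1) * v n ≤ s n * (s (2*n) + n + 1))
    (H2 : ∀ n, s n + r * v n ≤ r * v (n + c))
    (α : ℝ) (hα : α < 3) (H3 : ∀ᶠ n : ℕ in atTop, (v n : ℝ) ≤ (n : ℝ) ^ α) : False := by
  -- enlarge α
  obtain ⟨β, hβ2, hβ3, H4⟩ : ∃ β : ℝ, 2 ≤ β ∧ β < 3 ∧ ∀ᶠ n : ℕ in atTop, (v n : ℝ) ≤ (n : ℝ) ^ β := by
    refine ⟨max α 2, le_max_right _ _, max_lt hα (by norm_num), ?_⟩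
    filter_upwards [H3, eventually_ge_atTop 1] with n hn h1
    exact hn.trans (Real.rpow_le_rpow_of_exponent_le (by exact_mod_cast h1) (le_max_left _ _))
  -- frequently doubling
  have freq : ∀ N : ℕ, ∃ M, N ≤ M ∧ v (8*M) ≤ 512 * v M := by
    intro N
    by_contra! hcon
    obtain ⟨N1, hN1⟩ := eventually_atTop.1 H4
    set M0 := N + N1 + 1 with hM0
    have h1 : ∀ i : ℕ, 512 ^ i ≤ v (8^i * M0) := by
      intro i
      induction i with
      | zero => simpa using hv1 _
      | succ i ih =>
        have := hcon (8^i * M0) (by nlinarith [Nat.one_le_pow i 8 (by norm_num)])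
        rw [pow_succ, pow_succ, mul_comm (8^i) 8, mul_assoc]
        omega
    have h2 : ∀ i : ℕ, ((8:ℝ) ^ (3 - β)) ^ i ≤ (M0:ℝ)^β := by
      intro i
      have h3 : ((512 ^ i : ℕ) : ℝ) ≤ ((8^i * M0 : ℕ):ℝ)^β := by
        refine le_trans (by exact_mod_cast h1 i) (hN1 _ ?_)
        nlinarith [Nat.one_le_pow i 8 (by norm_num)]
      push_cast at h3
      rw [Real.mul_rpow (by positivity) (by positivity)] at h3
      have h4 : (512:ℝ)^i = ((8:ℝ)^(3-β))^i * ((8:ℝ)^i)^β := by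
        rw [← Real.rpow_natCast ((8:ℝ)^(3-β)), ← Real.rpow_mul (by norm_num), ← Real.rpow_natCast 8,
          ← Real.rpow_mul (by norm_num), ← Real.rpow_add (by norm_num)]
        have : (512:ℝ) = (8:ℝ)^(3:ℝ) := by norm_num
        rw [this, ← Real.rpow_natCast, ← Real.rpow_mul (by norm_num)]
        congr 1; ring
      rw [h4, mul_comm] at h3
      exact le_of_mul_le_mul_left h3 (by positivity)
    have h5 : 1 < (8:ℝ)^(3-β) := Real.one_lt_rpow (by norm_num) (by linarith)
    obtain ⟨i, hi⟩ := pow_unbounded_of_one_lt ((M0:ℝ)^β) h5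
    exact absurd (h2 i) (not_le.2 hi)
  set T := 1024 * r * c with hT
  -- good n
  have good : ∀ N : ℕ, ∃ n, N ≤ n ∧ 1 ≤ n ∧ n * (s n + s (2*n)) ≤ 2 * T * v n := by
    intro N
    obtain ⟨M, hM, hM2⟩ := freq (N + c + 1)
    have e1 : ∑ n ∈ Finset.range M, s (M + n) ≤ r * c * v (8*M) := by
      have h1 := sum_shift_le v hv M c M
      have h2 : ∑ n ∈ Finset.range M, (s (M+n) + r * v (M+n)) ≤
        ∑ n ∈ Finset.range M, r * v (M+n+c) := Finset.sum_le_sum fun n _ => H2 _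
      rw [Finset.sum_add_distrib, ← Finset.mul_sum, ← Finset.mul_sum] at h2
      have h3 : v (M + M + c) ≤ v (8*M) := hv (by omega)
      have h4 := Nat.mul_le_mul_left r h1
      have h5 := Nat.mul_le_mul_left (r*c) h3
      nlinarith
    have e2 : ∑ n ∈ Finset.range M, s (2*(M + n)) ≤ r * c * v (8*M) := by
      have h1 := sum_shift_le v hv (2*M) c (2*M)
      have h0 : ∑ n ∈ Finset.range M, s (2*(M + n)) ≤ ∑ n ∈ Finset.range (2*M), s (2*M + n) := by
        have := Finset.sum_le_sum_of_subset (f := fun n => s (2*M+n))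
          (s := (Finset.range M).image (fun n => 2*n)) (t := Finset.range (2*M)) (by
            intro x hx
            simp only [Finset.mem_image, Finset.mem_range] at hx ⊢
            omega)
        rw [Finset.sum_image (by intro a _ b _ h; simpa using h)] at this
        simpa [mul_add] using this
      have h2 : ∑ n ∈ Finset.range (2*M), (s (2*M+n) + r * v (2*M+n)) ≤
        ∑ n ∈ Finset.range (2*M), r * v (2*M+n+c) := Finset.sum_le_sum fun n _ => H2 _
      rw [Finset.sum_add_distrib, ← Finset.mul_sum, ← Finset.mul_sum] at h2
      have h3 : v (2*M + 2*M + c) ≤ v (8*M) := hv (by omega)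
      have h4 := Nat.mul_le_mul_left r h1
      have h5 := Nat.mul_le_mul_left (r*c) h3
      nlinarith
    have e3 : ∑ n ∈ Finset.range M, (s (M+n) + s (2*(M+n))) ≤ T * v M := by
      rw [Finset.sum_add_distrib]
      have := Nat.mul_le_mul_left (r*c) hM2
      rw [hT]; nlinarith
    have hMpos : 0 < M := by omega
    obtain ⟨n, hn, hn2⟩ : ∃ n ∈ Finset.range M, M * (s (M+n) + s (2*(M+n))) ≤ T * v M := by
      by_contra! hcon
      have h6 : ∑ n ∈ Finset.range M, (T * v M) < ∑ n ∈ Finset.range M, M * (s (M+n) + s (2*(M+n))) :=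
        Finset.sum_lt_sum_of_nonempty ⟨0, by simpa using hMpos⟩ hcon
      rw [← Finset.mul_sum (f := fun n => s (M+n) + s (2*(M+n))), Finset.sum_const, Finset.card_range, smul_eq_mul] at h6
      have := Nat.mul_le_mul_left M e3
      omega
    refine ⟨M + n, by omega, by omega, ?_⟩
    have hn : n < M := by simpa using hn
    have h7 : T * v M ≤ T * v (M+n) := Nat.mul_le_mul_left _ (hv (by omega))
    calc (M+n) * (s (M+n) + s (2*(M+n))) ≤ (2*M) * (s (M+n) + s (2*(M+n))) :=
          Nat.mul_le_mul_right _ (by omega)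
      _ ≤ 2 * (T * v (M+n)) := by rw [mul_assoc]; omega
      _ = _ := by ring
  have final : ∀ N : ℕ, ∃ n, N ≤ n ∧ 1 ≤ n ∧ n^3 ≤ 4*T^2 * v n + 4 * T * n^2 := by
    intro N
    obtain ⟨n, h1, h2, h3⟩ := good N
    refine ⟨n, h1, h2, ?_⟩
    set σ := s n + s (2*n)
    have h4 : (n+1) * v n ≤ σ * (σ + n + 1) :=
      (H1 n).trans (Nat.mul_le_mul (by omega) (by omega))
    have h5 : n^2 * (n+1) * v n ≤ (n * σ) * (n * σ + n * (n+1)) := by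
      have := Nat.mul_le_mul_left (n^2) h4
      nlinarith
    have h6 : (n * σ) * (n * σ + n * (n+1)) ≤ (2*T*v n) * (2*T*v n + n*(n+1)) :=
      Nat.mul_le_mul h3 (by omega)
    have h7 : (n^2*(n+1)) * v n ≤ (2*T*(2*T*v n + n*(n+1))) * v n := by
      calc _ ≤ _ := h5.trans h6
        _ = _ := by ring
    have h8 := Nat.le_of_mul_le_mul_right h7 (hv1 n)
    have h9 : n * (n+1) ≤ 2 * n^2 := by nlinarith
    have h10 := Nat.mul_le_mul_left (2*T) h9
    nlinarith
  obtain ⟨N1, hN1⟩ := eventually_atTop.1 H4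
  have h1 : Tendsto (fun n : ℕ => (n:ℝ)^(3-β)) atTop atTop :=
    (tendsto_rpow_atTop (by linarith)).comp tendsto_natCast_atTop_atTop
  obtain ⟨N2, hN2⟩ := eventually_atTop.1 (h1.eventually_gt_atTop (4*(T:ℝ)^2 + 4*T))
  obtain ⟨n, hn, hn1, hn2⟩ := final (N1 + N2)
  have a1 := hN1 n (by omega)
  have a2 := hN2 n (by omega)
  have hnpos : (1:ℝ) ≤ n := by exact_mod_cast hn1
  have a3 : (n:ℝ)^2 ≤ (n:ℝ)^β := by
    rw [← Real.rpow_natCast]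
    exact Real.rpow_le_rpow_of_exponent_le hnpos (by exact_mod_cast hβ2)
  have a4 : (n:ℝ)^3 ≤ 4*(T:ℝ)^2 * v n + 4*T*(n:ℝ)^2 := by exact_mod_cast hn2
  have a5 : (n:ℝ)^3 = (n:ℝ)^(3-β) * (n:ℝ)^β := by
    rw [← Real.rpow_add (by linarith), ← Real.rpow_natCast]
    congr 1; push_cast; ring
  have a6 : 0 < (n:ℝ)^β := by positivity
  have a7 : (4*(T:ℝ)^2 + 4*T) * (n:ℝ)^β < (n:ℝ)^(3-β) * (n:ℝ)^β := by
    exact mul_lt_mul_of_pos_right a2 a6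
  have a8 : 4*(T:ℝ)^2 * v n ≤ 4*(T:ℝ)^2 * (n:ℝ)^β := by gcongr
  have a9 : 4*(T:ℝ) * (n:ℝ)^2 ≤ 4*(T:ℝ) * (n:ℝ)^β := by gcongr
  nlinarith

variable {K Q : Type*} [Field K] [Ring Q] [Algebra K Q]

lemma fd_pow (V : Submodule K Q) [h : FiniteDimensional K V] (n : ℕ) :
    FiniteDimensional K ↥(V ^ n) := by
  have : V.FG := Module.Finite.iff_fg.1 h
  exact Module.Finite.iff_fg.2 (this.pow n)

lemma gk_mono {V W : Submodule K Q} [FiniteDimensional K W] (h : V ≤ W) :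
    gkWrt K V ≤ gkWrt K W := by
  refine limsup_le_limsup (Eventually.of_forall fun n => ?_)
  have := fd_pow W n
  have h1 := Submodule.finrank_mono (show V ^ n ≤ W ^ n from pow_le_pow_left' h n)
  rw [EReal.coe_le_coe_iff]
  have hl : 0 ≤ Real.log n := Real.log_natCast_nonneg n
  rcases Nat.eq_zero_or_pos (Module.finrank K ↥(V ^ n)) with h0 | h0
  · rw [h0]; simp
    exact div_nonneg (Real.log_natCast_nonneg _) hl
  · gcongr

lemma gk_le_one {W : Submodule K Q} (C : ℕ)
    (h : ∀ n, Module.finrank K ↥(W^n) ≤ C * (n+1)) : gkWrt K W ≤ 1 := by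
  have lim : Tendsto (fun n : ℕ => ((Real.log (2*(C+1)) / Real.log n + 1 : ℝ) : EReal)) atTop
      (nhds ((1:ℝ):EReal)) := by
    refine (continuous_coe_real_ereal.tendsto _).comp ?_
    have : Tendsto (fun n : ℕ => Real.log n) atTop atTop :=
      Real.tendsto_log_atTop.comp tendsto_natCast_atTop_atTop
    simpa using ((tendsto_const_nhds (x := Real.log (2*(C+1)))).div_atTop this).add_const 1
  have e := lim.limsup_eq
  have : ((1:ℝ):EReal) = 1 := rfl
  rw [← this, ← e]
  refine limsup_le_limsup ?_
  filter_upwards [eventually_ge_atTop 2] with n hn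
  rw [EReal.coe_le_coe_iff]
  have hn' : (2:ℝ) ≤ n := by exact_mod_cast hn
  have hl : 0 < Real.log n := Real.log_pos (by linarith)
  rw [div_add_one hl.ne']
  gcongr
  rw [← Real.log_mul (by positivity) (by positivity)]
  rcases Nat.eq_zero_or_pos (Module.finrank K ↥(W ^ n)) with h0 | h0
  · rw [h0]; simp
    apply Real.log_nonneg
    nlinarith [(Nat.cast_nonneg C : (0:ℝ) ≤ C)]
  · apply Real.log_le_log (by exact_mod_cast h0)
    have h1 : (Module.finrank K ↥(W^n) : ℝ) ≤ C * (n+1) := by exact_mod_cast h n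
    nlinarith [(Nat.cast_nonneg C : (0:ℝ) ≤ C)]

lemma gk_lt_three {V : Submodule K Q} (h : gkWrt K V < 3) :
    ∃ α : ℝ, α < 3 ∧ ∀ᶠ n : ℕ in atTop, (Module.finrank K ↥(V^n) : ℝ) ≤ (n:ℝ)^α := by
  obtain ⟨α, h1, h2⟩ := EReal.lt_iff_exists_real_btwn.1 h
  refine ⟨α, by
    have h3 : ((α:ℝ):EReal) < ((3:ℝ):EReal) := h2
    exact EReal.coe_lt_coe_iff.1 h3, ?_⟩
  have := eventually_lt_of_limsup_lt h1
  filter_upwards [this, eventually_ge_atTop 2] with n hn hn2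
  rw [EReal.coe_lt_coe_iff] at hn
  have hn' : (2:ℝ) ≤ n := by exact_mod_cast hn2
  have hl : 0 < Real.log n := Real.log_pos (by linarith)
  rw [div_lt_iff₀ hl] at hn
  rcases Nat.eq_zero_or_pos (Module.finrank K ↥(V ^ n)) with h0 | h0
  · rw [h0]; push_cast; positivity
  · have hp : (0:ℝ) < Module.finrank K ↥(V^n) := by exact_mod_cast h0
    rw [← Real.log_le_log_iff hp (by positivity), Real.log_rpow (by linarith)]
    exact hn.le

lemma pow_mono_sub {W : Submodule K Q} (h1 : (1:Q) ∈ W) {m n : ℕ} (h : m ≤ n) : W^m ≤ W^n :=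
  pow_le_pow_right₀ (Submodule.one_le.2 h1) h

lemma mem_pow_of_adjoin {W : Submodule K Q} (h1 : (1:Q) ∈ W) {x : Q}
    (hx : x ∈ Algebra.adjoin K (W : Set Q)) : ∃ n, x ∈ W ^ n := by
  induction hx using Algebra.adjoin_induction with
  | mem x hx => exact ⟨1, by simpa using hx⟩
  | algebraMap c => exact ⟨0, by simp [Submodule.mem_one]⟩
  | add x y _ _ hx hy =>
    obtain ⟨a, ha⟩ := hx
    obtain ⟨b, hb⟩ := hy
    exact ⟨max a b, add_mem (pow_mono_sub h1 (le_max_left _ _) ha) (pow_mono_sub h1 (le_max_right _ _) hb)⟩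
  | mul x y _ _ hx hy =>
    obtain ⟨a, ha⟩ := hx
    obtain ⟨b, hb⟩ := hy
    exact ⟨a + b, by rw [pow_add]; exact Submodule.mul_mem_mul ha hb⟩

lemma pow_le_adjoin (W : Submodule K Q) (n : ℕ) :
    W ^ n ≤ Subalgebra.toSubmodule (Algebra.adjoin K (W : Set Q)) := by
  induction n with
  | zero => rw [pow_zero, Submodule.one_le]; exact one_mem (Algebra.adjoin K (W : Set Q))
  | succ n ih =>
    rw [pow_succ, Submodule.mul_le]
    intro a ha b hb
    exact mul_mem (S := Subalgebra K Q) (s := Algebra.adjoin K (W : Set Q)) (ih ha)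
      (Algebra.subset_adjoin hb)

end Growth

section Artin
variable {K B : Type*} [Field K] [DivisionRing B] [Algebra K B]

lemma artin_dep (L : Subalgebra K B) [FiniteDimensional K L]
    (hL : ∀ y : B, (∀ x ∈ L, y * x = x * y) → y ∈ L) {ι : Type*} [Fintype ι]
    (hι : Module.finrank K L < Fintype.card ι) (x : ι → B) :
    ∃ c : ι → B, (∀ j, c j ∈ L) ∧ c ≠ 0 ∧ ∑ j, c j * x j = 0 := by
  classical
  set h := Module.finrank K L
  let b := Module.finBasis K L
  let P : (ι → B) → Prop := fun c => ∀ l ∈ L, ∑ j, c j * (l * x j) = 0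
  have ex : ∃ c, c ≠ 0 ∧ P c := by
    let T : (ι → B) →ₗ[B] (Fin h → B) :=
      LinearMap.pi fun i => ∑ j, (LinearMap.toSpanSingleton B B ((b i : B) * x j)).comp (LinearMap.proj j)
    have hT : LinearMap.ker T ≠ ⊥ := LinearMap.ker_ne_bot_of_finrank_lt (by simpa using hι)
    obtain ⟨c, hc, hc0⟩ := Submodule.exists_mem_ne_zero_of_ne_bot hT
    refine ⟨c, hc0, fun l hl => ?_⟩
    have h1 : ∀ i, ∑ j, c j * ((b i : B) * x j) = 0 := by
      intro i
      have := congrFun (LinearMap.mem_ker.1 hc) i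
      simpa [T] using this
    have h2 : (⟨l, hl⟩ : L) = ∑ i, b.repr ⟨l, hl⟩ i • b i := (b.sum_repr _).symm
    have h3 : l = ∑ i, b.repr ⟨l, hl⟩ i • (b i : B) := by
      have := congrArg L.val h2
      rw [map_sum] at this
      exact this
    rw [h3]
    simp only [Finset.sum_mul, Finset.mul_sum, smul_mul_assoc, mul_smul_comm]
    rw [Finset.sum_comm]
    refine Finset.sum_eq_zero fun i _ => ?_
    rw [← Finset.smul_sum, h1, smul_zero]
  -- minimal support
  let N : Set ℕ := {n | ∃ c, c ≠ 0 ∧ P c ∧ (Finset.univ.filter fun j => c j ≠ 0).card = n}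
  have hN : N.Nonempty := by
    obtain ⟨c, h1, h2⟩ := ex
    exact ⟨_, c, h1, h2, rfl⟩
  obtain ⟨c, hc0, hcP, hcN⟩ := Nat.sInf_mem hN
  obtain ⟨j0, hj0⟩ : ∃ j, c j ≠ 0 := by
    by_contra! h; exact hc0 (funext h)
  let c' : ι → B := fun j => (c j0)⁻¹ * c j
  have hc'P : P c' := by
    intro l hl
    simp only [c', mul_assoc, ← Finset.mul_sum]
    rw [hcP l hl, mul_zero]
  have hc'j : c' j0 = 1 := by simp [c', hj0]
  have hc'L : ∀ j, c' j ∈ L := by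
    intro j
    apply hL
    intro l' hl'
    let d : ι → B := fun j => c' j * l' - l' * c' j
    have hdP : P d := by
      intro l hl
      simp only [d, sub_mul, Finset.sum_sub_distrib]
      have h1 := hc'P (l' * l) (mul_mem hl' hl)
      have h2 := hc'P l hl
      simp only [mul_assoc, ← Finset.mul_sum] at h1 h2 ⊢
      rw [h1, h2]; simp
    have hd : d = 0 := by
      by_contra hd0
      have h1 : (Finset.univ.filter fun j => d j ≠ 0).card < (Finset.univ.filter fun j => c j ≠ 0).card := by
        apply Finset.card_lt_card
        refine (Finset.ssubset_iff_of_subset ?_).2 ⟨j0, by simp [hj0], by simp [d, hc'j]⟩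
        intro j hj
        simp only [Finset.mem_filter, Finset.mem_univ, true_and] at hj ⊢
        intro h0; apply hj; simp [d, c', h0]
      have h2 : sInf N ≤ _ := Nat.sInf_le ⟨d, hd0, hdP, rfl⟩
      omega
    exact sub_eq_zero.1 (congrFun hd j)
  refine ⟨c', hc'L, fun h => ?_, ?_⟩
  · rw [h] at hc'j; simp at hc'j
  · simpa using hc'P 1 (one_mem L)

lemma artin_fd [Algebra.IsAlgebraic K B] (L : Subalgebra K B) [FiniteDimensional K L]
    (hL : ∀ y : B, (∀ x ∈ L, y * x = x * y) → y ∈ L) : FiniteDimensional K B := by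
  let LF : Subfield B := { L.toSubring with
    inv_mem' := fun x hx => IsIntegral.inv_mem (Algebra.IsIntegral.isIntegral (R := K) x) hx }
  have hr : Module.rank LF B ≤ (Module.finrank K L : ℕ) := by
    apply rank_le
    intro s hs
    by_contra! hcon
    obtain ⟨c, h1, h2, h3⟩ := artin_dep L hL (ι := s) (by simpa using hcon) (fun i => (i : B))
    rw [Fintype.linearIndependent_iff] at hs
    apply h2
    funext j
    have := hs (fun j => (⟨c j, h1 j⟩ : LF)) (by simpa [Subfield.smul_def] using h3) j
    simpa using congrArg Subtype.val this
  have hf : Module.Finite LF B := Module.rank_lt_aleph0_iff.1 (hr.trans_lt (Cardinal.natCast_lt_aleph0))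
  obtain ⟨S, hS⟩ := hf.fg_top
  have h1 : (⊤ : Submodule K B) ≤ Subalgebra.toSubmodule L * Submodule.span K (S : Set B) := by
    intro y _
    have hy : y ∈ Submodule.span LF (S : Set B) := by rw [hS]; trivial
    induction hy using Submodule.span_induction with
    | mem x hx =>
      have := Submodule.mul_mem_mul (M := Subalgebra.toSubmodule L) (one_mem L) (Submodule.subset_span (R := K) hx)
      simpa using this
    | zero => exact zero_mem _
    | add x y _ _ hx hy => exact add_mem (hx trivial) (hy trivial)
    | smul a x _ hx =>
      have h2 := hx trivial
      have h3 := Submodule.mul_mem_mul (M := Subalgebra.toSubmodule L) a.2 h2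
      rw [← mul_assoc] at h3
      have h4 : Subalgebra.toSubmodule L * Subalgebra.toSubmodule L = Subalgebra.toSubmodule L :=
        L.isIdempotentElem_toSubmodule
      rw [h4] at h3
      exact h3
  have h2 : (Subalgebra.toSubmodule L * Submodule.span K (S : Set B)).FG := by
    apply Submodule.FG.mul
    · exact Module.Finite.iff_fg.1 ‹_›
    · exact ⟨S, rfl⟩
  exact ⟨by rw [← top_le_iff.1 h1]; exact h2⟩

theorem alg_fd [Algebra.IsAlgebraic K B] (l : ℕ)
    (hl : ∀ L : Subalgebra K B, FiniteDimensional K L → Module.finrank K L ≤ l) :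
    FiniteDimensional K B := by
  classical
  let P : ℕ → Prop := fun n => ∃ L : Subalgebra K B, FiniteDimensional K L ∧
    (∀ x ∈ L, ∀ y ∈ L, x * y = y * x) ∧ Module.finrank K L = n
  have h0 : P (Module.finrank K (⊥ : Subalgebra K B)) := by
    refine ⟨⊥, inferInstance, ?_, rfl⟩
    rintro x hx y hy
    obtain ⟨a, rfl⟩ := Algebra.mem_bot.1 hx
    exact Algebra.commutes _ _
  have hb : Module.finrank K (⊥ : Subalgebra K B) ≤ l := hl _ inferInstance
  obtain ⟨L, fL, cL, eL⟩ := Nat.findGreatest_spec (P := P) hb h0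
  apply artin_fd L
  intro y hy
  obtain ⟨S, hS⟩ : (Subalgebra.toSubmodule L).FG := Module.Finite.iff_fg.1 fL
  have hcomm : ∀ a ∈ (insert y S : Set B), ∀ b ∈ (insert y S : Set B), a * b = b * a := by
    have hSL : ∀ a ∈ (S : Set B), a ∈ L := fun a ha => by
      have : a ∈ Submodule.span K (S : Set B) := Submodule.subset_span ha
      rwa [hS] at this
    rintro a (rfl | ha) b (rfl | hb)
    · rfl
    · exact hy b (hSL b hb)
    · exact (hy a (hSL a ha)).symm
    · exact cL a (hSL a ha) b (hSL b hb)
  let N := Algebra.adjoin K (insert y S : Set B)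
  have hc : IsMulCommutative N := Algebra.isMulCommutative_adjoin K hcomm
  have hfin : FiniteDimensional K N := by
    have : Algebra.FiniteType K N := by
      rw [← Subalgebra.fg_iff_finiteType]
      exact ⟨insert y S, by simp [N]⟩
    have : Algebra.IsIntegral K N := by
      refine ⟨fun x => ?_⟩
      have h1 : IsIntegral K (x : B) := Algebra.IsIntegral.isIntegral _
      exact (isIntegral_algHom_iff N.val Subtype.val_injective).1 h1
    let _ : CommRing N :=
      { (inferInstance : Ring N) with mul_comm := fun a b => hc.is_comm.comm a b }
    exact Algebra.IsIntegral.finite (R := K) (A := N)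
  have hLN : L ≤ N := by
    intro x hx
    have : x ∈ Submodule.span K (S : Set B) := by rw [hS]; exact hx
    have h2 : Submodule.span K (S : Set B) ≤ Subalgebra.toSubmodule N := by
      rw [Submodule.span_le]
      intro a ha; exact Algebra.subset_adjoin (Set.mem_insert_of_mem _ ha)
    exact h2 this
  have hPN : P (Module.finrank K N) := ⟨N, hfin, fun a ha b hb => by
    have := hc.is_comm.comm (⟨a, ha⟩ : N) ⟨b, hb⟩
    exact congrArg Subtype.val this, rfl⟩
  have h3 : Module.finrank K N ≤ Module.finrank K L := by
    rw [eL]; exact Nat.le_findGreatest (hl N hfin) hPN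
  have h4 : Subalgebra.toSubmodule L = Subalgebra.toSubmodule N := 
    Submodule.eq_of_le_of_finrank_le hLN h3
  have h5 : y ∈ Subalgebra.toSubmodule N := Algebra.subset_adjoin (Set.mem_insert _ _)
  rw [← h4] at h5
  exact h5
end Artin

section BaseChange
variable {K Q : Type*} [Field K] [DivisionRing Q] [Algebra K Q]
  {F R : Type*} [Field F] [Ring R] [NoZeroDivisors R] [Nontrivial R] [Algebra F R]

/-- base change data -/
structure BC (K Q F R : Type*) [Field K] [DivisionRing Q] [Algebra K Q]
    [Field F] [Ring R] [Algebra F R] where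
  C : Q →+* R
  hK : ∀ c : K, ∃ c' : F, C (algebraMap K Q c) = algebraMap F R c'
  ind : ∀ {ι : Type} (v : ι → Q), LinearIndependent K v → LinearIndependent F (fun i => C (v i))

variable (β : BC K Q F R)

lemma BC.smul (c : K) : ∃ c' : F, ∀ x, β.C (c • x) = c' • β.C x := by
  obtain ⟨c', h⟩ := β.hK c
  refine ⟨c', fun x => ?_⟩
  rw [Algebra.smul_def, map_mul, h, Algebra.smul_def]

/-- extension of scalars of a subspace -/
def BC.ext (S : Submodule K Q) : Submodule F R := Submodule.span F (β.C '' S)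

lemma BC.mem_ext {S : Submodule K Q} {x : Q} (hx : x ∈ S) : β.C x ∈ β.ext S :=
  Submodule.subset_span ⟨x, hx, rfl⟩

/-- pull back of a subspace -/
def BC.pull (U : Submodule F R) : Submodule K Q where
  carrier := {x | β.C x ∈ U}
  add_mem' := by intro a b ha hb; simp only [Set.mem_setOf_eq, map_add] at *; exact U.add_mem ha hb
  zero_mem' := by simp
  smul_mem' := by
    intro c x hx
    obtain ⟨c', h⟩ := β.smul c
    simp only [Set.mem_setOf_eq, h] at *
    exact U.smul_mem _ hx

lemma BC.mem_pull {U : Submodule F R} {x : Q} : x ∈ β.pull U ↔ β.C x ∈ U := Iff.rfl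

lemma BC.ext_span (s : Set Q) : β.ext (Submodule.span K s) = Submodule.span F (β.C '' s) := by
  apply le_antisymm
  · rw [BC.ext, Submodule.span_le]
    rintro _ ⟨x, hx, rfl⟩
    have : Submodule.span K s ≤ β.pull (Submodule.span F (β.C '' s)) := by
      rw [Submodule.span_le]
      intro y hy
      exact Submodule.subset_span ⟨y, hy, rfl⟩
    exact this hx
  · exact Submodule.span_mono (Set.image_mono Submodule.subset_span)

lemma BC.fd_ext (S : Submodule K Q) [h : FiniteDimensional K S] : FiniteDimensional F (β.ext S) := by
  obtain ⟨s, hs⟩ : S.FG := Module.Finite.iff_fg.1 h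
  rw [← hs, β.ext_span]
  exact FiniteDimensional.span_of_finite F (s.finite_toSet.image _)

lemma BC.finrank_ext (S : Submodule K Q) [FiniteDimensional K S] :
    Module.finrank F (β.ext S) = Module.finrank K S := by
  let b := Module.finBasis K S
  have h1 : LinearIndependent K (fun i => (b i : Q)) :=
    b.linearIndependent.map' S.subtype (by simp)
  have h2 := β.ind _ h1
  have h3 : S = Submodule.span K (Set.range fun i => (b i : Q)) := by
    have := congrArg (Submodule.map S.subtype) b.span_eq
    rw [Submodule.map_span, ← Set.range_comp] at this
    simp only [Submodule.map_top, Submodule.range_subtype] at this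
    exact this.symm
  have h4 : β.ext S = Submodule.span F (Set.range fun i => β.C (b i : Q)) := by
    conv_lhs => rw [h3]
    rw [β.ext_span, ← Set.range_comp]; rfl
  rw [h4, finrank_span_eq_card h2, Fintype.card_fin]

lemma BC.finrank_le_of_mem (S : Submodule K Q) [FiniteDimensional K S] (U : Submodule F R)
    [FiniteDimensional F U] (h : ∀ x ∈ S, β.C x ∈ U) : Module.finrank K S ≤ Module.finrank F U := by
  rw [← β.finrank_ext]
  apply Submodule.finrank_mono
  rw [BC.ext, Submodule.span_le]
  rintro _ ⟨x, hx, rfl⟩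
  exact h x hx

lemma BC.nb_ext {ι : Type*} (w : ι → Q) (S : Submodule K Q) :
    nb (lm F fun i => β.C (w i)) (β.ext S) = β.ext (nb (lm K w) S) := by
  apply le_antisymm
  · refine nb_le (Submodule.span_mono (Set.image_mono (le_nb _ _))) ?_
    intro i x hx
    have : β.ext S ≤ (β.ext (nb (lm K w) S)).comap (lm F (fun i => β.C (w i)) i) := by
      rw [BC.ext, Submodule.span_le]
      rintro _ ⟨y, hy, rfl⟩
      have := β.mem_ext (mem_nb (lm K w) i hy)
      simpa [lm] using this
    exact this hx
  · rw [BC.ext, Submodule.span_le]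
    rintro _ ⟨y, hy, rfl⟩
    have : nb (lm K w) S ≤ β.pull (nb (lm F fun i => β.C (w i)) (β.ext S)) := by
      refine nb_le ?_ ?_
      · intro x hx; exact le_nb _ _ (β.mem_ext hx)
      · intro i x hx
        have := mem_nb (lm F fun i => β.C (w i)) i (β.mem_ext hx)
        rw [BC.mem_pull]
        simpa [lm] using this
    exact this hy

lemma BC.bd_ext {ι : Type*} [Finite ι] (w : ι → Q) (S : Submodule K Q) [FiniteDimensional K S] :
    bd (lm F fun i => β.C (w i)) (β.ext S) = bd (lm K w) S := by
  unfold bd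
  rw [β.nb_ext, β.finrank_ext, β.finrank_ext]

lemma pow_eq_words {r : ℕ} (w : Fin r → Q) (n : ℕ) :
    (Submodule.span K (Set.range w)) ^ n =
      Submodule.span K {x | ∃ L : List (Fin r), L.length = n ∧ x = (L.map w).prod} := by
  induction n with
  | zero =>
    rw [pow_zero, Submodule.one_eq_span]
    congr 1
    ext x
    simp only [Set.mem_singleton_iff, List.length_eq_zero_iff, Set.mem_setOf_eq]
    constructor
    · rintro rfl; exact ⟨[], rfl, by simp⟩
    · rintro ⟨L, rfl, rfl⟩; simp
  | succ n ih =>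
    rw [pow_succ', ih, Submodule.span_mul_span]
    congr 1
    ext x
    rw [Set.mem_mul]
    constructor
    · rintro ⟨_, ⟨j, rfl⟩, _, ⟨L, hL, rfl⟩, rfl⟩
      exact ⟨j :: L, by simp [hL], by simp⟩
    · rintro ⟨L, hL, rfl⟩
      obtain ⟨j, L', rfl⟩ := List.exists_cons_of_length_eq_add_one hL
      exact ⟨w j, ⟨j, rfl⟩, _, ⟨L', by simpa using hL, rfl⟩, by simp⟩

lemma BC.words_mem {r : ℕ} (w : Fin r → Q) (n : ℕ) (U : Submodule F R)
    (h : ∀ L : List (Fin r), L.length = n → (L.map fun i => β.C (w i)).prod ∈ U) {x : Q}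
    (hx : x ∈ (Submodule.span K (Set.range w)) ^ n) : β.C x ∈ U := by
  rw [pow_eq_words] at hx
  have : Submodule.span K {x | ∃ L : List (Fin r), L.length = n ∧ x = (L.map w).prod} ≤ β.pull U := by
    rw [Submodule.span_le]
    rintro _ ⟨L, hL, rfl⟩
    have := h L hL
    show β.C _ ∈ U
    rw [map_list_prod, List.map_map]
    exact this
  exact this hx

/-- polynomial independence -/
def PI (x : Q) {m : ℕ} (b : Fin m → Q) : Prop :=
  ∀ d : Fin m → Polynomial K, ∑ a, Polynomial.aeval x (d a) * b a = 0 → d = 0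

lemma bd_one_poly (U : Submodule F (Polynomial F)) [FiniteDimensional F U]
    (h : (1 : Polynomial F) ∈ U) : 1 ≤ bd (lm F fun _ : Unit => (Polynomial.X : Polynomial F)) U := by
  by_contra hcon
  have h1 := bd_add (lm F fun _ : Unit => (Polynomial.X : Polynomial F)) U
  have h2 : U = nb (lm F fun _ : Unit => (Polynomial.X : Polynomial F)) U :=
    Submodule.eq_of_le_of_finrank_le (le_nb _ _) (by omega)
  have h3 : ∀ n, (Polynomial.X : Polynomial F)^n ∈ U := by
    intro n
    induction n with
    | zero => simpa using h
    | succ n ih =>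
      rw [h2, pow_succ']
      exact mem_nb (lm F fun _ : Unit => (Polynomial.X : Polynomial F)) () ih
  have h4 : U = ⊤ := by
    rw [eq_top_iff]
    intro p _
    rw [p.as_sum_range_C_mul_X_pow]
    refine U.sum_mem fun i _ => ?_
    rw [← Polynomial.smul_eq_C_mul]
    exact U.smul_mem _ (h3 i)
  subst h4
  have : Module.Finite F (Polynomial F) := Module.Finite.equiv (Submodule.topEquiv)
  exact Polynomial.not_finite this

lemma BC.pi_bound {r : ℕ} (w : Fin r → Q) (i0 : Fin r) {m : ℕ} (b : Fin m → Q)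
    (hb : PI (K := K) (w i0) b) (U : Submodule F R) [FiniteDimensional F U]
    (hU : ∀ a, β.C (b a) ∈ U) : m ≤ bd (lm F fun i => β.C (w i)) U := by
  set x := w i0
  have h1 : bd (lm F fun _ : Unit => β.C x) U ≤ bd (lm F fun i => β.C (w i)) U := by
    have h2 := bd_add (lm F fun _ : Unit => β.C x) U
    have h3 := bd_add (lm F fun i => β.C (w i)) U
    have h4 : nb (lm F fun _ : Unit => β.C x) U ≤ nb (lm F fun i => β.C (w i)) U :=
      nb_le (le_nb _ _) fun _ y hy => mem_nb (lm F fun i => β.C (w i)) i0 hy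
    have := Submodule.finrank_mono h4
    omega
  refine le_trans ?_ h1
  let f : Fin m → Polynomial F →ₗ[F] R := fun a =>
    (LinearMap.mulRight F (β.C (b a))).comp (Polynomial.aeval (β.C x)).toLinearMap
  have hline := line_lemma (φ := lm F fun _ : Unit => (Polynomial.X : Polynomial F))
    (ψ := lm F fun _ : Unit => β.C x) f (by intro a i y; simp [f, lm, mul_assoc]) ?_
    (S := {1}) (N := 1) ?_ U ?_
  · simpa using hline
  · -- joint injectivity
    let gK : (Fin m → Polynomial K) →ₗ[K] Q := LinearMap.lsum K (fun _ => Polynomial K) K fun a =>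
      (LinearMap.mulRight K (b a)).comp (Polynomial.aeval x).toLinearMap
    let gF : (Fin m → Polynomial F) →ₗ[F] R := LinearMap.lsum F (fun _ => Polynomial F) F f
    let bK := Pi.basis (fun _ : Fin m => Polynomial.basisMonomials K)
    let bF := Pi.basis (fun _ : Fin m => Polynomial.basisMonomials F)
    have e1 : LinearIndependent K (fun i => gK (bK i)) := by
      refine bK.linearIndependent.map' gK ?_
      rw [LinearMap.ker_eq_bot']
      intro d hd
      apply hb
      simpa [gK] using hd
    have e2 := β.ind _ e1
    have e3 : (fun i => β.C (gK (bK i))) = fun i => gF (bF i) := by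
      funext ⟨a, n⟩
      have k1 : gK (bK ⟨a, n⟩) = x ^ n * b a := by
        simp only [gK, bK, Pi.basis_apply, LinearMap.lsum_apply, LinearMap.sum_apply,
          LinearMap.comp_apply, LinearMap.proj_apply]
        rw [Finset.sum_eq_single a]
        · simp [Polynomial.aeval_monomial]
        · intro c _ hc; simp [hc]
        · simp
      have k2 : gF (bF ⟨a, n⟩) = β.C x ^ n * β.C (b a) := by
        simp only [gF, bF, f, Pi.basis_apply, LinearMap.lsum_apply, LinearMap.sum_apply,
          LinearMap.comp_apply, LinearMap.proj_apply]
        rw [Finset.sum_eq_single a]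
        · simp [Polynomial.aeval_monomial]
        · intro c _ hc; simp [hc]
        · simp
      rw [k1, k2]; simp
    rw [e3] at e2
    intro d hd
    have hd' : gF d = 0 := by simpa [gF] using hd
    have h5 := bF.linearCombination_repr d
    rw [← h5, Finsupp.apply_linearCombination] at hd'
    have h6 := (linearIndependent_iff.1 e2) _ hd'
    rwa [LinearEquiv.map_eq_zero_iff] at h6
  · intro V fV sV
    exact bd_one_poly V (by simpa using sV)
  · rintro s rfl a
    simpa [f] using hU a

/-- if the number of polynomially independent elements is bounded, the growth is linear -/
lemma linear_growth {r : ℕ} (w : Fin r → Q) (i0 : Fin r) (h1 : (1:Q) ∈ Submodule.span K (Set.range w))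
    (hx : Transcendental K (w i0)) (l : ℕ)
    (hl : ∀ (m : ℕ) (b : Fin m → Q), (∀ a, b a ∈ Algebra.adjoin K (Set.range w)) →
      PI (K := K) (w i0) b → m ≤ l) : gkWrt K (Submodule.span K (Set.range w)) ≤ 1 := by
  classical
  set x := w i0 with hxdef
  let P : ℕ → Prop := fun m => ∃ b : Fin m → Q, (∀ a, b a ∈ Algebra.adjoin K (Set.range w)) ∧
    PI (K := K) x b
  have P0 : P 0 := ⟨Fin.elim0, fun a => a.elim0, fun d _ => Subsingleton.elim _ _⟩
  have hPm := Nat.findGreatest_spec (P := P) (Nat.zero_le l) P0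
  set m := Nat.findGreatest P l with hm
  obtain ⟨b, hbB, hb⟩ := hPm
  have hmax : ¬ P (m+1) := by
    intro h
    obtain ⟨b', h2, h3⟩ := id h
    have := Nat.le_findGreatest (hl _ b' h2 h3) h
    omega
  have hinj : ∀ p : Polynomial K, Polynomial.aeval x p = 0 → p = 0 :=
    fun p hp => (transcendental_iff.1 hx) p hp
  have dep : ∀ y ∈ Algebra.adjoin K (Set.range w), ∃ p : Polynomial K, p ≠ 0 ∧
      ∃ d : Fin m → Polynomial K, Polynomial.aeval x p * y = ∑ a, Polynomial.aeval x (d a) * b a := by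
    intro y hy
    have h2 : ¬ PI (K := K) x (Fin.cons y b : Fin (m+1) → Q) := by
      intro h
      refine hmax ⟨_, fun a => ?_, h⟩
      refine Fin.cases ?_ (fun a => ?_) a
      · simpa using hy
      · simpa using hbB a
    unfold PI at h2
    push Not at h2
    obtain ⟨d, hd, hd0⟩ := h2
    rw [Fin.sum_univ_succ] at hd
    simp only [Fin.cons_zero, Fin.cons_succ] at hd
    refine ⟨d 0, fun h0 => hd0 ?_, fun a => - d a.succ, ?_⟩
    · rw [h0, map_zero, zero_mul, zero_add] at hd
      have := hb _ hd
      funext a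
      refine Fin.cases h0 (fun a => ?_) a
      exact congrFun this a
    · simp only [map_neg, neg_mul, Finset.sum_neg_distrib]
      exact eq_neg_of_add_eq_zero_left hd
  have mpos : 0 < m := by
    by_contra h0
    obtain ⟨p, hp, d, hd⟩ := dep 1 (one_mem _)
    have : IsEmpty (Fin m) := by
      have : m = 0 := by omega
      rw [this]; infer_instance
    rw [Finset.univ_eq_empty, Finset.sum_empty, mul_one] at hd
    exact hp (hinj p hd)
  have hdep := fun (a : Fin m) (j : Fin r) => dep (b a * w j)
    (mul_mem (hbB a) (Algebra.subset_adjoin ⟨j, rfl⟩))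
  choose p hp d hd using hdep
  let pp : Polynomial K := ∏ a, ∏ j, p a j
  have hpp : pp ≠ 0 := Finset.prod_ne_zero_iff.2 fun a _ => Finset.prod_ne_zero_iff.2 fun j _ => hp a j
  have hd' : ∀ a j, ∃ d' : Fin m → Polynomial K,
      Polynomial.aeval x pp * (b a * w j) = ∑ c, Polynomial.aeval x (d' c) * b c := by
    intro a j
    have hdvd : p a j ∣ pp :=
      (Finset.dvd_prod_of_mem (fun j => p a j) (Finset.mem_univ j)).trans
        (Finset.dvd_prod_of_mem (fun a => ∏ j, p a j) (Finset.mem_univ a))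
    obtain ⟨e, he⟩ := hdvd
    refine ⟨fun c => e * d a j c, ?_⟩
    rw [he, mul_comm, map_mul, mul_assoc, hd, Finset.mul_sum]
    simp [mul_assoc]
  choose d' hd' using hd'
  obtain ⟨h, hh⟩ : ∃ h : ℕ, ∀ a j c, (d' a j c).natDegree ≤ h := by
    refine ⟨∑ a, ∑ j, ∑ c, (d' a j c).natDegree, fun a j c => ?_⟩
    calc _ ≤ ∑ c, (d' a j c).natDegree :=
          Finset.single_le_sum (f := fun c => (d' a j c).natDegree) (fun _ _ => Nat.zero_le _) (Finset.mem_univ c)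
      _ ≤ ∑ j, ∑ c, (d' a j c).natDegree :=
          Finset.single_le_sum (f := fun j => ∑ c, (d' a j c).natDegree) (fun _ _ => Nat.zero_le _) (Finset.mem_univ j)
      _ ≤ _ := Finset.single_le_sum (f := fun a => ∑ j, ∑ c, (d' a j c).natDegree) (fun _ _ => Nat.zero_le _) (Finset.mem_univ a)
  let Z : ℕ → Submodule K Q := fun N => Submodule.span K (Set.range fun q : Fin N × Fin m => x ^ (q.1:ℕ) * b q.2)
  have Zmem : ∀ N (f : Polynomial K) c, f.natDegree < N → Polynomial.aeval x f * b c ∈ Z N := by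
    intro N f c hf
    rw [Polynomial.aeval_eq_sum_range' hf, Finset.sum_mul]
    refine Submodule.sum_mem _ fun i hi => ?_
    rw [smul_mul_assoc]
    exact Submodule.smul_mem _ _ (Submodule.subset_span ⟨(⟨i, by simpa using hi⟩, c), rfl⟩)
  have Zmul : ∀ N (f : Polynomial K), f.natDegree ≤ h → ∀ z ∈ Z N, Polynomial.aeval x f * z ∈ Z (N + h) := by
    intro N f hf z hz
    have : Z N ≤ (Z (N+h)).comap (LinearMap.mulLeft K (Polynomial.aeval x f)) := by
      rw [Submodule.span_le]
      rintro _ ⟨⟨i, c⟩, rfl⟩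
      have h3 := Zmem (N+h) (f * Polynomial.X^(i:ℕ)) c (by
        have := Polynomial.natDegree_mul_le (p := f) (q := Polynomial.X^(i:ℕ))
        rw [Polynomial.natDegree_X_pow] at this
        have := i.2
        omega)
      simpa [mul_assoc] using h3
    exact this hz
  have words : ∀ L : List (Fin r), ∀ a,
      Polynomial.aeval x pp ^ L.length * (b a * (L.map w).prod) ∈ Z (h * L.length + 1) := by
    intro L
    induction L with
    | nil =>
      intro a
      have := Zmem 1 1 a (by simp)
      simpa using this
    | cons j L ih =>
      intro a
      have h3 : Polynomial.aeval x pp ^ (j :: L).length * (b a * ((j :: L).map w).prod) =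
          ∑ c, Polynomial.aeval x (d' a j c) * (Polynomial.aeval x pp ^ L.length * (b c * (L.map w).prod)) := by
        have h4 : ∀ c, Polynomial.aeval x (d' a j c) * (Polynomial.aeval x pp ^ L.length * (b c * (L.map w).prod))
            = Polynomial.aeval x pp ^ L.length * (Polynomial.aeval x (d' a j c) * b c) * (L.map w).prod := by
          intro c
          have : Commute (Polynomial.aeval x (d' a j c)) (Polynomial.aeval x pp ^ L.length) := by
            rw [← map_pow]
            show _ * _ = _ * _
            rw [← map_mul, mul_comm, map_mul]
          rw [← mul_assoc, this.eq]; simp [mul_assoc]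
        simp only [h4, ← Finset.mul_sum, ← Finset.sum_mul, ← hd']
        simp [pow_succ, mul_assoc]
      rw [h3]
      have h5 : h * (j :: L).length + 1 = h * L.length + 1 + h := by simp; ring
      rw [h5]
      exact Submodule.sum_mem _ fun c _ => Zmul _ _ (hh a j c) _ (ih c)
  refine gk_le_one ((h+1) * m) fun n => ?_
  let a0 : Fin m := ⟨0, mpos⟩
  have hb0 : b a0 ≠ 0 := by
    intro h0
    have := hb (Pi.single a0 1) (by
      rw [Finset.sum_eq_single a0]
      · simp [h0]
      · intro c _ hc; simp [hc]
      · simp)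
    have := congrFun this a0
    simp at this
  have hp0 : Polynomial.aeval x pp ≠ 0 := fun h0 => hpp (hinj _ h0)
  let T : Q →ₗ[K] Q := LinearMap.mulLeft K (Polynomial.aeval x pp ^ n * b a0)
  have Ti : Function.Injective T := fun y z hyz =>
    mul_left_cancel₀ (mul_ne_zero (pow_ne_zero _ hp0) hb0) hyz
  rw [← finrank_map_inj T Ti]
  have hZ : (Submodule.span K (Set.range w) ^ n).map T ≤ Z (h*n+1) := by
    rw [Submodule.map_le_iff_le_comap, pow_eq_words, Submodule.span_le]
    rintro _ ⟨L, hL, rfl⟩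
    have := words L a0
    rw [hL] at this
    simpa [T, mul_assoc] using this
  have fZ : FiniteDimensional K (Z (h*n+1)) := FiniteDimensional.span_of_finite K (Set.finite_range _)
  refine (Submodule.finrank_mono hZ).trans ?_
  refine (finrank_range_le_card (R := K) _).trans ?_
  rw [Fintype.card_prod, Fintype.card_fin, Fintype.card_fin]
  nlinarith [Nat.zero_le (h*m), Nat.zero_le (m*n), Nat.zero_le (h*m*n)]

end BaseChange

section Unb
variable {K Q : Type*} [Field K] [DivisionRing Q] [Algebra K Q]
  {F R : Type*} [Field F] [Ring R] [NoZeroDivisors R] [Nontrivial R] [Algebra F R]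
variable (β : BC K Q F R)

lemma fd_subalgebra_bound {r : ℕ} (w : Fin r → Q) (h1 : (1:Q) ∈ Submodule.span K (Set.range w))
    (hg : 1 < gkWrt K (Submodule.span K (Set.range w))) (l : ℕ)
    (L : Subalgebra K Q) (fL : FiniteDimensional K L) (hinv : ∀ x ∈ L, x⁻¹ ∈ L)
    (U0 : Submodule F R) (fU0 : FiniteDimensional F U0) (hU0 : ∀ x ∈ L, β.C x ∈ U0)
    (hb : bd (lm F fun i => β.C (w i)) U0 ≤ l) : Module.finrank K L ≤ l := by
  classical
  set φ := lm F fun i => β.C (w i) with hφ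
  set S : Set R := β.C '' (L : Set Q) with hS
  have hSU0 : S ⊆ U0 := by rintro _ ⟨x, hx, rfl⟩; exact hU0 x hx
  have ext : ∃ U, Tight φ S U := by
    have : {n | ∃ U : Submodule F R, FiniteDimensional F U ∧ S ⊆ U ∧ bd φ U = n}.Nonempty :=
      ⟨_, U0, fU0, hSU0, rfl⟩
    exact Nat.sInf_mem this
  let N : Set ℕ := {n | ∃ U, Tight φ S U ∧ Module.finrank F U = n}
  have hN : N.Nonempty := by
    obtain ⟨U, hU⟩ := ext
    exact ⟨_, U, hU, rfl⟩
  obtain ⟨U, hU, hmin⟩ := Nat.sInf_mem hN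
  have hmin' : ∀ U', Tight φ S U' → Module.finrank F U ≤ Module.finrank F U' := by
    intro U' h'; rw [hmin]; exact Nat.sInf_le ⟨U', h', rfl⟩
  have fU := hU.1
  have hUl : bd φ U ≤ l := by
    rw [hU.2.2]; exact (Lam_le U0 hSU0).trans hb
  let LS : Submodule K Q := Subalgebra.toSubmodule L
  have fLS : FiniteDimensional K LS := fL
  -- stability under right multiplication
  have inj : ∀ c : R, c ≠ 0 → Function.Injective (LinearMap.mulRight F c) :=
    fun c hc x y hxy => mul_right_cancel₀ hc hxy
  have Cne : ∀ c : Q, c ≠ 0 → β.C c ≠ 0 := fun c hc => (map_ne_zero_iff _ β.C.injective).2 hc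
  have st1 : ∀ c ∈ L, ∀ u ∈ U, u * β.C c ∈ U := by
    intro c hc u hu
    by_cases hc0 : c = 0
    · simp [hc0]
    have hT : Tight φ S (U.map (LinearMap.mulRight F (β.C c))) := by
      refine ⟨inferInstance, ?_, ?_⟩
      · rintro _ ⟨x, hx, rfl⟩
        refine ⟨β.C (x * c⁻¹), hU.2.1 ⟨x * c⁻¹, mul_mem hx (hinv c hc), rfl⟩, ?_⟩
        simp [← map_mul, mul_assoc, hc0]
      · rw [bd_map (φ := φ) (ψ := φ) _ (by intro i x; simp [φ, lm, mul_assoc]) (inj _ (Cne c hc0))]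
        exact hU.2.2
    have h2 := hmin' _ (hU.inf_tight hT)
    have h3 : U ⊓ U.map (LinearMap.mulRight F (β.C c)) = U :=
      Submodule.eq_of_le_of_finrank_le inf_le_left h2
    have h4 : U ≤ U.map (LinearMap.mulRight F (β.C c)) := inf_eq_left.1 h3
    have h5 : U = U.map (LinearMap.mulRight F (β.C c)) :=
      Submodule.eq_of_le_of_finrank_le h4 (by rw [finrank_map_inj _ (inj _ (Cne c hc0))])
    rw [h5]; exact ⟨u, hu, rfl⟩
  have st2 : ∀ c ∈ β.ext LS, ∀ u ∈ U, u * c ∈ U := by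
    intro c hc u hu
    have : β.ext LS ≤ U.comap (LinearMap.mulLeft F u) := by
      rw [BC.ext, Submodule.span_le]
      rintro _ ⟨x, hx, rfl⟩
      exact st1 x hx u hu
    exact this hc
  have st3 : ∀ c ∈ β.ext LS, c ≠ 0 → ∀ z, z * c ∈ U → z ∈ U := by
    intro c hc hc0 z hz
    have h4 : U.map (LinearMap.mulRight F c) ≤ U := by
      rintro _ ⟨u, hu, rfl⟩; exact st2 c hc u hu
    have h5 := Submodule.eq_of_le_of_finrank_le h4 (by rw [finrank_map_inj _ (inj _ hc0)])
    rw [← h5] at hz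
    obtain ⟨u, hu, hu2⟩ := hz
    rw [← inj c hc0 hu2]; exact hu
  -- not stable
  have hne : ¬ nb φ U ≤ U := by
    intro hle
    have hw : ∀ L' : List (Fin r), (L'.map fun i => β.C (w i)).prod ∈ U := by
      intro L'
      induction L' with
      | nil =>
        have : (1:R) ∈ S := ⟨1, one_mem L, by simp⟩
        simpa using hU.2.1 this
      | cons j L' ih =>
        have := hle (mem_nb φ j ih)
        simpa [φ, lm] using this
    have : gkWrt K (Submodule.span K (Set.range w)) ≤ 1 := by
      refine gk_le_one (Module.finrank F U) fun n => ?_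
      have : FiniteDimensional K (Submodule.span K (Set.range w)) :=
        FiniteDimensional.span_of_finite K (Set.finite_range _)
      have := fd_pow (Submodule.span K (Set.range w)) n
      refine (β.finrank_le_of_mem _ U fun x hx => β.words_mem w n U (fun L _ => hw L) hx).trans ?_
      exact Nat.le_mul_of_pos_right _ (by omega)
    exact absurd this (not_le.2 hg)
  obtain ⟨z, hz, hzU⟩ := SetLike.not_le_iff_exists.1 hne
  have z0 : z ≠ 0 := by rintro rfl; exact hzU (zero_mem _)
  have hmapz : (β.ext LS).map (LinearMap.mulLeft F z) ≤ nb φ U := by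
    rintro _ ⟨c, hc, rfl⟩
    have : nb φ U ≤ (nb φ U).comap (LinearMap.mulRight F c) := by
      refine nb_le ?_ ?_
      · intro u hu; exact le_nb _ _ (st2 c hc u hu)
      · intro i u hu
        have := mem_nb φ i (st2 c hc u hu)
        simpa [φ, lm, mul_assoc] using this
    exact this hz
  have hdis : (β.ext LS).map (LinearMap.mulLeft F z) ⊓ U = ⊥ := by
    rw [eq_bot_iff]
    rintro _ ⟨⟨c, hc, rfl⟩, hc2⟩
    by_cases hc0 : c = 0
    · simp [hc0]
    · exact absurd (st3 c hc hc0 z hc2) hzU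
  have := β.fd_ext LS
  have e1 := Submodule.finrank_sup_add_finrank_inf_eq ((β.ext LS).map (LinearMap.mulLeft F z)) U
  rw [hdis, finrank_bot, add_zero, finrank_map_inj _ (fun x y hxy => mul_left_cancel₀ z0 hxy),
    β.finrank_ext] at e1
  have e2 := Submodule.finrank_mono (sup_le hmapz (le_nb φ U))
  have e3 := bd_add φ U
  have e4 : Module.finrank K LS = Module.finrank K L := rfl
  omega

theorem unb_thm {r : ℕ} (w : Fin r → Q) (h1 : (1:Q) ∈ Submodule.span K (Set.range w))
    (hg : 1 < gkWrt K (Submodule.span K (Set.range w)))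
    (hor : (∃ i0, Transcendental K (w i0)) ∨ ∀ x ∈ Algebra.adjoin K (Set.range w), IsAlgebraic K x)
    (l : ℕ) : ∃ n : ℕ, ∀ U : Submodule F R, FiniteDimensional F U →
      (∀ L : List (Fin r), L.length = n → (L.map fun i => β.C (w i)).prod ∈ U) →
        l < bd (lm F fun i => β.C (w i)) U := by
  classical
  by_contra hcon
  push Not at hcon
  have fW : FiniteDimensional K (Submodule.span K (Set.range w)) :=
    FiniteDimensional.span_of_finite K (Set.finite_range _)
  have hU : ∀ n, ∃ U : Submodule F R, FiniteDimensional F U ∧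
      (∀ x ∈ (Submodule.span K (Set.range w)) ^ n, β.C x ∈ U) ∧
      bd (lm F fun i => β.C (w i)) U ≤ l := by
    intro n
    obtain ⟨U, fU, h2, h3⟩ := hcon n
    exact ⟨U, fU, fun x hx => β.words_mem w n U h2 hx, h3⟩
  have had : Algebra.adjoin K ((Submodule.span K (Set.range w) : Submodule K Q) : Set Q) =
      Algebra.adjoin K (Set.range w) := Algebra.adjoin_span K
  -- finitely many elements lie in a common power
  have com : ∀ s : Finset Q, (∀ x ∈ s, x ∈ Algebra.adjoin K (Set.range w)) →
      ∃ n, ∀ x ∈ s, x ∈ (Submodule.span K (Set.range w)) ^ n := by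
    intro s
    induction s using Finset.induction_on with
    | empty => intro _; exact ⟨0, by simp⟩
    | insert a s ha ih =>
      intro h
      obtain ⟨n, hn⟩ := ih fun x hx => h x (Finset.mem_insert_of_mem hx)
      obtain ⟨m, hm⟩ := mem_pow_of_adjoin h1 (by rw [had]; exact h a (Finset.mem_insert_self _ _))
      refine ⟨max n m, fun x hx => ?_⟩
      rcases Finset.mem_insert.1 hx with rfl | hx
      · exact pow_mono_sub h1 (le_max_right _ _) hm
      · exact pow_mono_sub h1 (le_max_left _ _) (hn x hx)
  rcases hor with ⟨i0, hi⟩ | halg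
  · refine absurd (linear_growth w i0 h1 hi l ?_) (not_le.2 hg)
    intro m b hb hPI
    obtain ⟨n, hn⟩ := com (Finset.univ.image b) (by
      intro x hx
      obtain ⟨a, _, rfl⟩ := Finset.mem_image.1 hx
      exact hb a)
    obtain ⟨U, fU, h2, h3⟩ := hU n
    exact (β.pi_bound w i0 b hPI U fun a => h2 _ (hn _ (Finset.mem_image_of_mem _ (Finset.mem_univ a)))).trans h3
  · let B := Algebra.adjoin K (Set.range w)
    have Binv : ∀ x ∈ B, x⁻¹ ∈ B := fun x hx => IsIntegral.inv_mem (halg x hx).isIntegral hx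
    let Bf : Subfield Q := { B.toSubring with inv_mem' := Binv }
    let algB : Algebra K Bf := inferInstanceAs (Algebra K B)
    have isalg : Algebra.IsAlgebraic K Bf := by
      refine ⟨fun x => ?_⟩
      have h2 := halg (x : Q) x.2
      let v : Bf →ₐ[K] Q := B.val
      exact (isAlgebraic_algHom_iff v (Subtype.val_injective)).1 h2
    have hfd : FiniteDimensional K Bf := by
      apply alg_fd l
      intro L fL
      let v : Bf →ₐ[K] Q := B.val
      have hv : Function.Injective v := Subtype.val_injective
      have e : L ≃ₗ[K] L.map v := (Subalgebra.equivMapOfInjective L v hv).toLinearEquiv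
      have fL' : FiniteDimensional K (L.map v) := e.finiteDimensional
      rw [e.finrank_eq]
      have hLB : ∀ x ∈ L.map v, x ∈ B := by
        rintro _ ⟨x, _, rfl⟩; exact x.2
      obtain ⟨s, hs⟩ : (Subalgebra.toSubmodule (L.map v)).FG := Module.Finite.iff_fg.1 fL'
      obtain ⟨n, hn⟩ := com s (fun x hx => hLB x (by
        have : x ∈ Submodule.span K (s : Set Q) := Submodule.subset_span hx
        rw [hs] at this; exact this))
      obtain ⟨U, fU, h2, h3⟩ := hU n
      refine fd_subalgebra_bound β w h1 hg l (L.map v) fL' ?_ U fU ?_ h3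
      · intro x hx
        exact IsIntegral.inv_mem (halg x (hLB x hx)).isIntegral hx
      · intro x hx
        apply h2
        have h4 : Submodule.span K (s : Set Q) ≤ (Submodule.span K (Set.range w)) ^ n := by
          rw [Submodule.span_le]; exact hn
        apply h4
        rw [hs]; exact hx
    have hfd' : FiniteDimensional K (Subalgebra.toSubmodule B) := hfd
    refine absurd (gk_le_one (Module.finrank K (Subalgebra.toSubmodule B)) fun n => ?_) (not_le.2 hg)
    have h5 : (Submodule.span K (Set.range w)) ^ n ≤ Subalgebra.toSubmodule B := by
      have := pow_le_adjoin (Submodule.span K (Set.range w)) n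
      rw [had] at this
      exact this
    exact (Submodule.finrank_mono h5).trans (Nat.le_mul_of_pos_right _ (by omega))
end Unb

section Hahn
variable {Γ : Type} [AddCommGroup Γ] [LinearOrder Γ] [IsOrderedAddMonoid Γ]
variable {K Q : Type*} [Field K] [DivisionRing Q] [Algebra K Q]

/-- coefficientwise extension of the structure map -/
noncomputable def hMap (Γ : Type) [AddCommGroup Γ] [LinearOrder Γ] [IsOrderedAddMonoid Γ]
    (K Q : Type*) [Field K] [DivisionRing Q] [Algebra K Q] :
    HahnSeries Γ K →+* HahnSeries Γ Q where
  toFun x := x.map (algebraMap K Q)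
  map_one' := by
    ext a
    simp only [HahnSeries.map_coeff, HahnSeries.coeff_one]
    split_ifs <;> simp
  map_mul' x y := HahnSeries.map_mul (algebraMap K Q : K →ₙ+* Q)
  map_zero' := by ext; simp
  map_add' x y := by ext; simp

lemma hMap_coeff (x : HahnSeries Γ K) (a : Γ) :
    (hMap Γ K Q x).coeff a = algebraMap K Q (x.coeff a) := rfl

noncomputable instance hAlg : Algebra (HahnSeries Γ K) (HahnSeries Γ Q) :=
  RingHom.toAlgebra' (hMap Γ K Q) (by
    intro c x
    ext a
    rw [HahnSeries.coeff_mul, HahnSeries.coeff_mul]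
    refine Finset.sum_equiv (Equiv.prodComm _ _) (fun _ => Finset.swap_mem_antidiagonal.symm) ?_
    intro i _
    simp only [hMap_coeff, Equiv.prodComm_apply, Prod.fst_swap, Prod.snd_swap]
    exact Algebra.commutes _ _)

lemma hAlg_def (x : HahnSeries Γ K) :
    algebraMap (HahnSeries Γ K) (HahnSeries Γ Q) x = hMap Γ K Q x := rfl

lemma hsmul_coeff (f : HahnSeries Γ K) (q : Q) (a : Γ) :
    (f • (HahnSeries.C q : HahnSeries Γ Q)).coeff a = f.coeff a • q := by
  rw [Algebra.smul_def, hAlg_def, HahnSeries.C_apply, HahnSeries.coeff_mul_single_zero, hMap_coeff,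
    Algebra.smul_def]

/-- the base change to Hahn series -/
noncomputable def hBC (Γ : Type) [AddCommGroup Γ] [LinearOrder Γ] [IsOrderedAddMonoid Γ]
    (K Q : Type*) [Field K] [DivisionRing Q] [Algebra K Q] :
    BC K Q (HahnSeries Γ K) (HahnSeries Γ Q) where
  C := HahnSeries.C
  hK c := by
    refine ⟨HahnSeries.C c, ?_⟩
    ext a
    rw [hAlg_def, hMap_coeff]
    simp only [HahnSeries.C_apply, HahnSeries.coeff_single]
    split_ifs <;> simp
  ind v hv := by
    rw [linearIndependent_iff'] at hv ⊢
    intro s f hf i hi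
    ext a
    refine hv s (fun i => (f i).coeff a) ?_ i hi
    have := congrArg (fun x : HahnSeries Γ Q => x.coeff a) hf
    simpa only [HahnSeries.coeff_sum, hsmul_coeff, HahnSeries.coeff_zero] using this

/-- ring automorphism induced by an order automorphism -/
noncomputable def hE {T : Type*} [Ring T] (σ : Γ ≃+ Γ) (hσ : ∀ g g', σ g ≤ σ g' ↔ g ≤ g') :
    HahnSeries Γ T ≃+* HahnSeries Γ T :=
  RingEquiv.ofRingHom
    (HahnSeries.embDomainRingHom σ.toAddMonoidHom σ.injective hσ)
    (HahnSeries.embDomainRingHom σ.symm.toAddMonoidHom σ.symm.injective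
      (fun g g' => by rw [← hσ]; simp))
    (by
      ext x a
      obtain ⟨b, rfl⟩ := σ.surjective a
      obtain ⟨c, rfl⟩ := σ.symm.surjective b
      refine (HahnSeries.embDomain_mk_coeff σ.injective hσ).trans ?_
      refine (HahnSeries.embDomain_mk_coeff σ.symm.injective _).trans ?_
      simp)
    (by
      ext x a
      obtain ⟨b, rfl⟩ := σ.symm.surjective a
      obtain ⟨c, rfl⟩ := σ.surjective b
      refine (HahnSeries.embDomain_mk_coeff σ.symm.injective _).trans ?_
      refine (HahnSeries.embDomain_mk_coeff σ.injective hσ).trans ?_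
      simp)

lemma hE_coeff {T : Type*} [Ring T] (σ : Γ ≃+ Γ) (hσ : ∀ g g', σ g ≤ σ g' ↔ g ≤ g')
    (x : HahnSeries Γ T) (a : Γ) : (hE σ hσ x).coeff (σ a) = x.coeff a :=
  HahnSeries.embDomain_mk_coeff σ.injective hσ

lemma hE_single {T : Type*} [Ring T] (σ : Γ ≃+ Γ) (hσ : ∀ g g', σ g ≤ σ g' ↔ g ≤ g')
    (a : Γ) (c : T) : hE σ hσ (HahnSeries.single a c) = HahnSeries.single (σ a) c :=
  HahnSeries.embDomain_single

/-- the automorphism data -/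
noncomputable def hAut {r : ℕ} (w : Fin r → Q) (σ : Γ ≃+ Γ) (hσ : ∀ g g', σ g ≤ σ g' ↔ g ≤ g') :
    Aut (HahnSeries Γ K) (HahnSeries Γ Q) (fun i => (hBC Γ K Q).C (w i)) where
  s := hE σ hσ
  e := hE σ hσ
  he c x := by
    rw [Algebra.smul_def, Algebra.smul_def, map_mul]
    congr 1
    ext a
    obtain ⟨b, rfl⟩ := σ.surjective a
    rw [hE_coeff, hAlg_def, hAlg_def, hMap_coeff, hMap_coeff, hE_coeff]
  hw j := by
    show hE σ hσ (HahnSeries.single 0 _) = HahnSeries.single 0 _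
    rw [hE_single, map_zero]

/-- series with coefficients in `D` -/
noncomputable def hD (Γ : Type) [AddCommGroup Γ] [LinearOrder Γ] [IsOrderedAddMonoid Γ]
    (D : Subring Q) (hDK : ∀ c : K, algebraMap K Q c ∈ D) :
    Subalgebra (HahnSeries Γ K) (HahnSeries Γ Q) where
  carrier := {z | ∀ a, z.coeff a ∈ D}
  mul_mem' := by
    intro x y hx hy a
    rw [HahnSeries.coeff_mul]
    exact D.sum_mem fun i _ => D.mul_mem (hx _) (hy _)
  add_mem' := by
    intro x y hx hy a
    exact D.add_mem (hx a) (hy a)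
  algebraMap_mem' := fun c a => hDK _

lemma hD_C {D : Subring Q} {hDK : ∀ c : K, algebraMap K Q c ∈ D} {x : Q} (hx : x ∈ D) :
    (hBC Γ K Q).C x ∈ hD Γ D hDK := by
  intro a
  show (HahnSeries.single 0 x).coeff a ∈ D
  rw [HahnSeries.coeff_single]
  split_ifs
  · exact hx
  · exact D.zero_mem

lemma hcoeff_mul_lead (d y : HahnSeries Γ Q) (γ : Γ) (hd : ∀ a < γ, d.coeff a = 0) :
    (d * y).coeff (γ + y.order) = d.coeff γ * y.leadingCoeff := by
  by_cases hd0 : d = 0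
  · simp [hd0]
  by_cases hy0 : y = 0
  · simp [hy0]
  have h1 : γ ≤ d.order := by
    by_contra h
    push Not at h
    have := hd _ h
    rw [← HahnSeries.leadingCoeff_eq] at this
    exact hd0 (HahnSeries.leadingCoeff_eq_zero.1 this)
  rcases h1.eq_or_lt with h | h
  · rw [h, HahnSeries.coeff_mul_order_add_order, HahnSeries.leadingCoeff_eq]
  · rw [HahnSeries.coeff_eq_zero_of_lt_order h, zero_mul]
    apply HahnSeries.coeff_eq_zero_of_lt_order
    rw [HahnSeries.order_mul hd0 hy0]
    exact add_lt_add_left h _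

lemma hD_inj {D : Subring Q} {hDK : ∀ c : K, algebraMap K Q c ∈ D} {m : ℕ} (u : Fin m → Q)
    (y : HahnSeries Γ Q)
    (hu : ∀ c : Fin m → Q, (∀ a, c a ∈ D) → ∑ a, c a * (y.leadingCoeff * u a) = 0 → c = 0)
    (d : Fin m → hD Γ D hDK)
    (h : ∑ a, (d a : HahnSeries Γ Q) * (y * (hBC Γ K Q).C (u a)) = 0) : d = 0 := by
  classical
  by_contra hne
  let s : Finset (Fin m) := Finset.univ.filter fun a => (d a : HahnSeries Γ Q) ≠ 0
  have hs : s.Nonempty := by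
    by_contra hemp
    apply hne
    funext a
    apply Subtype.ext
    by_contra h0
    exact hemp ⟨a, by simpa [s] using h0⟩
  obtain ⟨b, hb, hmin⟩ := s.exists_min_image (fun a => (d a : HahnSeries Γ Q).order) hs
  set γ := (d b : HahnSeries Γ Q).order
  have hz : ∀ a, ∀ g < γ, (d a : HahnSeries Γ Q).coeff g = 0 := by
    intro a g hg
    by_cases ha : (d a : HahnSeries Γ Q) = 0
    · simp [ha]
    · exact HahnSeries.coeff_eq_zero_of_lt_order (hg.trans_le (hmin a (by simpa [s] using ha)))
  have hc := hu (fun a => (d a : HahnSeries Γ Q).coeff γ) (fun a => (d a).2 γ) (by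
    have := congrArg (fun x : HahnSeries Γ Q => x.coeff (γ + y.order)) h
    simp only [HahnSeries.coeff_sum, HahnSeries.coeff_zero] at this
    rw [← this]
    refine Finset.sum_congr rfl fun a _ => ?_
    show _ = ((d a : HahnSeries Γ Q) * (y * HahnSeries.single 0 (u a))).coeff _
    rw [← mul_assoc, ← mul_assoc, HahnSeries.coeff_mul_single_zero, hcoeff_mul_lead _ _ _ (hz a)])
  have := congrFun hc b
  simp only [Pi.zero_apply] at this
  have hb' : (d b : HahnSeries Γ Q) ≠ 0 := by simpa [s] using hb
  apply hb'
  rw [← HahnSeries.leadingCoeff_eq_zero, HahnSeries.leadingCoeff_eq]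
  exact this

end Hahn

section Conc

/-- index set -/
abbrev Ix (r : ℕ) : Type := ℤ ×ₗ Fin r
/-- value group -/
abbrev Gm (r : ℕ) : Type := Lex (Ix r →₀ ℤ)

variable {r : ℕ}

/-- index of a letter -/
def ix (i : ℕ) (j : Fin r) : Ix r := toLex ((i : ℤ), j)

/-- value of a letter -/
noncomputable def gm (i : ℕ) (j : Fin r) : Gm r := toLex (Finsupp.single (ix i j) 1)

lemma gm_ne (i : ℕ) (j : Fin r) : gm i j ≠ 0 := by
  intro h
  have h1 : (Finsupp.single (ix i j) (1:ℤ)) = 0 := congrArg ofLex h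
  simp at h1

lemma le_iff_of_lt {Γ : Type} [LinearOrder Γ] (f : Γ → Γ) (h : ∀ a b, a < b → f a < f b) (a b : Γ) :
    f a ≤ f b ↔ a ≤ b := (show StrictMono f from fun a b => h a b).le_iff_le

/-- shift of indices -/
def shIx (r : ℕ) : Ix r ≃ Ix r where
  toFun x := toLex ((ofLex x).1 + 1, (ofLex x).2)
  invFun x := toLex ((ofLex x).1 - 1, (ofLex x).2)
  left_inv x := by simp
  right_inv x := by simp

lemma shIx_lt (x y : Ix r) : shIx r x < shIx r y ↔ x < y := by
  rw [Prod.Lex.lt_iff, Prod.Lex.lt_iff]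
  simp [shIx]

/-- shift of the value group -/
noncomputable def shG (r : ℕ) : Gm r ≃+ Gm r where
  toFun x := toLex (Finsupp.equivMapDomain (shIx r) (ofLex x))
  invFun x := toLex (Finsupp.equivMapDomain (shIx r).symm (ofLex x))
  left_inv x := by
    apply ofLex.injective; ext a; simp
  right_inv x := by
    apply ofLex.injective; ext a; simp
  map_add' x y := by
    apply ofLex.injective; ext a; simp

lemma shG_le (x y : Gm r) : shG r x ≤ shG r y ↔ x ≤ y := by
  apply le_iff_of_lt
  intro x y h
  rw [Finsupp.Lex.lt_iff] at h ⊢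
  obtain ⟨i, h1, h2⟩ := h
  refine ⟨shIx r i, fun j hj => ?_, ?_⟩
  · have : (shIx r).symm j < i := by rw [← shIx_lt]; simpa using hj
    simpa [shG] using h1 _ this
  · simpa [shG] using h2

lemma shG_gm (i : ℕ) (j : Fin r) : shG r (gm i j) = gm (i+1) j := by
  apply ofLex.injective
  simp [shG, gm, Finsupp.equivMapDomain_single, shIx, ix]

/-- transvection -/
noncomputable def tvG (a b : Ix r) (hab : a < b) : Gm r ≃+ Gm r where
  toFun x := toLex (ofLex x + Finsupp.single b (ofLex x a))
  invFun x := toLex (ofLex x - Finsupp.single b (ofLex x a))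
  left_inv x := by
    apply ofLex.injective; simp [hab.ne]
  right_inv x := by
    apply ofLex.injective; simp [hab.ne]
  map_add' x y := by
    apply ofLex.injective
    simp only [ofLex_toLex, ofLex_add, Finsupp.add_apply, Finsupp.single_add]
    abel

lemma tvG_le (a b : Ix r) (hab : a < b) (x y : Gm r) : tvG a b hab x ≤ tvG a b hab y ↔ x ≤ y := by
  apply le_iff_of_lt
  intro x y h
  rw [Finsupp.Lex.lt_iff] at h ⊢
  obtain ⟨i, h1, h2⟩ := h
  refine ⟨i, fun j hj => ?_, ?_⟩
  · have := h1 j hj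
    simp only [tvG, AddEquiv.coe_mk, Equiv.coe_fn_mk, ofLex_toLex, Finsupp.add_apply, this,
      Finsupp.single_apply]
    split_ifs with hb
    · rw [h1 a (hab.trans (hb ▸ hj))]
    · rfl
  · simp only [tvG, AddEquiv.coe_mk, Equiv.coe_fn_mk, ofLex_toLex, Finsupp.add_apply,
      Finsupp.single_apply]
    split_ifs with hb
    · rw [h1 a (hb ▸ hab)]; simpa using h2
    · simpa using h2

variable {K Q : Type*} [Field K] [DivisionRing Q] [Algebra K Q]

/-- generic coefficients -/
noncomputable def tt (K : Type*) [Field K] (r : ℕ) (i : ℕ) (j : Fin r) : HahnSeries (Gm r) K :=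
  HahnSeries.single (gm i j) 1

theorem hahn_words (w : Fin r → Q) (h1 : (1:Q) ∈ Submodule.span K (Set.range w))
    (hg : 1 < gkWrt K (Submodule.span K (Set.range w)))
    (hor : (∃ i0, Transcendental K (w i0)) ∨ ∀ x ∈ Algebra.adjoin K (Set.range w), IsAlgebraic K x)
    (k : ℕ) :
    LamGe (lm (HahnSeries (Gm r) K) fun i => (hBC (Gm r) K Q).C (w i))
      (gq (fun i => (hBC (Gm r) K Q).C (w i)) (tt K r) '' Set.Iic k) k := by
  classical
  refine generic_words _ (tt K r) (hAut w (shG r) shG_le) ?_ ?_ ?_ ?_ ?_ 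
    (unb_thm (hBC (Gm r) K Q) w h1 hg hor) k
  · intro i j
    show hE _ _ (HahnSeries.single _ _) = _
    rw [hE_single, shG_gm]; rfl
  · intro i i' hi j
    have hab : ix i j < ix i' j := by
      rw [Prod.Lex.lt_iff]; left; simpa [ix] using hi
    refine ⟨hAut w (tvG _ _ hab) (tvG_le _ _ hab), ?_, ?_⟩
    · show hE _ _ (HahnSeries.single _ _) = _
      rw [hE_single, tt, tt, HahnSeries.single_mul_single, mul_one]
      congr 2
      apply ofLex.injective
      simp [tvG, gm]
    · intro i0 j0 hne
      show hE _ _ (HahnSeries.single _ _) = _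
      rw [hE_single, tt]
      congr 2
      apply ofLex.injective
      have : ix i0 j0 ≠ ix i j := by
        intro h
        have h' := congrArg ofLex h
        simp only [ix, ofLex_toLex, Prod.mk.injEq, Nat.cast_inj] at h'
        rcases hne with h2 | h2
        · exact h2 h'.1
        · exact h2 h'.2
      simp [tvG, gm, Finsupp.single_apply, this]
  · intro i j h
    exact one_ne_zero (HahnSeries.single_eq_zero_iff.1 h)
  · intro i j h
    have := congrArg (fun x : HahnSeries (Gm r) K => x.coeff (gm i j)) h
    simp [tt, HahnSeries.coeff_one, gm_ne] at this
  · intro i h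
    have hw0 : ∀ j, w j = 0 := by
      intro j
      have := congrArg (fun x : HahnSeries (Gm r) Q => x.coeff (gm i j)) h
      simp only [gv, HahnSeries.coeff_sum, HahnSeries.coeff_zero] at this
      rw [← this, Finset.sum_eq_single j]
      · show _ = (tt K r i j • HahnSeries.C (w j)).coeff _
        rw [hsmul_coeff]; simp [tt]
      · intro b _ hb
        show (tt K r i b • HahnSeries.C (w b)).coeff _ = 0
        rw [hsmul_coeff, tt, HahnSeries.coeff_single_of_ne, zero_smul]
        intro he
        have h2 : Finsupp.single (ix i j) (1:ℤ) = Finsupp.single (ix i b) 1 := congrArg ofLex he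
        have h3 := (Finsupp.single_left_inj one_ne_zero).1 h2
        have h' := congrArg ofLex h3
        simp only [ix, ofLex_toLex, Prod.mk.injEq] at h'
        exact hb h'.2.symm
      · simp
    have : Submodule.span K (Set.range w) ≤ ⊥ := by
      rw [Submodule.span_le]
      rintro _ ⟨j, rfl⟩
      simp [hw0]
    exact one_ne_zero ((Submodule.mem_bot K).1 (this h1))

end Conc

section Indep
variable {K Q : Type*} [Field K] [DivisionRing Q] [Algebra K Q]

lemma left_indep (A : Subalgebra K Q) (V : Submodule K Q) (h1V : (1 : Q) ∈ V)
    (hVA : Algebra.adjoin K (V : Set Q) = A)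
    (hQuot : ∀ q : Q, ∃ a ∈ A, ∃ b ∈ A, b ≠ 0 ∧ q = b⁻¹ * a)
    (D : Subring Q) (hDinv : ∀ x ∈ D, x⁻¹ ∈ D)
    (hno : ¬ ∃ s : Finset Q, ∀ q : Q, ∃ c : Q → Q,
      (∀ x ∈ s, c x ∈ D) ∧ q = ∑ x ∈ s, c x * x)
    (y : Q) (hy : y ≠ 0) (n : ℕ) :
    ∃ u : Fin (n+1) → Q, (∀ a, u a ∈ V ^ n) ∧
      ∀ c : Fin (n+1) → Q, (∀ a, c a ∈ D) → ∑ a, c a * (y * u a) = 0 → c = 0 := by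
  classical
  let E : Subfield Q := { D with inv_mem' := hDinv }
  suffices h : ∃ u : Fin (n+1) → Q, (∀ a, u a ∈ V ^ n) ∧ LinearIndependent E (fun a => y * u a) by
    obtain ⟨u, hu, hi⟩ := h
    refine ⟨u, hu, fun c hc h0 => ?_⟩
    rw [Fintype.linearIndependent_iff] at hi
    funext a
    have := hi (fun a => (⟨c a, hc a⟩ : E)) (by simpa [Subfield.smul_def] using h0) a
    simpa using congrArg Subtype.val this
  induction n with
  | zero =>
    refine ⟨fun _ => 1, fun a => by simp [Submodule.mem_one], ?_⟩
    rw [Fintype.linearIndependent_iff]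
    intro g hg i
    rw [Fin.eq_zero i]
    simp only [Subfield.smul_def, mul_one, smul_eq_mul] at hg
    simpa [hy] using hg
  | succ n ih =>
    obtain ⟨u, hu, hi⟩ := ih
    set T : Submodule E Q := Submodule.span E (Set.range fun a => y * u a) with hT
    have fT : FiniteDimensional E T := FiniteDimensional.span_of_finite E (Set.finite_range _)
    by_cases hex : ∃ v ∈ V ^ (n+1), y * v ∉ T
    · obtain ⟨v, hv, hv2⟩ := hex
      refine ⟨Fin.snoc u v, fun a => ?_, ?_⟩
      · refine Fin.lastCases ?_ (fun a => ?_) a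
        · simpa using hv
        · simpa using pow_mono_sub h1V (Nat.le_succ n) (hu a)
      · have h2 := linearIndependent_finSnoc.2 ⟨hi, hv2⟩
        have e : (fun a => y * (Fin.snoc u v : Fin (n+2) → Q) a)
            = (Fin.snoc (fun a => y * u a) (y * v) : Fin (n+2) → Q) := by
          funext a
          refine Fin.lastCases ?_ (fun a => ?_) a
          · simp
          · simp
        rw [e]
        exact h2
    · exfalso
      push Not at hex
      let ρ : Q → (Q →ₗ[E] Q) := fun q =>
        { toFun := fun x => x * q
          map_add' := fun x y => add_mul _ _ _
          map_smul' := fun c x => by simp [Subfield.smul_def, mul_assoc] }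
      have hV : ∀ v ∈ V, ∀ t ∈ T, t * v ∈ T := by
        intro v hv t ht
        have : T ≤ T.comap (ρ v) := by
          conv_lhs => rw [hT]
          rw [Submodule.span_le]
          rintro _ ⟨a, rfl⟩
          show y * u a * v ∈ T
          rw [mul_assoc]
          exact hex _ (by rw [pow_succ]; exact Submodule.mul_mem_mul (hu a) hv)
        exact this ht
      have hA : ∀ a ∈ A, ∀ t ∈ T, t * a ∈ T := by
        intro a ha
        rw [← hVA] at ha
        induction ha using Algebra.adjoin_induction with
        | mem x hx => exact hV x hx
        | algebraMap c =>
          refine hV _ ?_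
          rw [Algebra.algebraMap_eq_smul_one]
          exact V.smul_mem _ h1V
        | add x y _ _ hx hy => intro t ht; rw [mul_add]; exact T.add_mem (hx t ht) (hy t ht)
        | mul x y _ _ hx hy => intro t ht; rw [← mul_assoc]; exact hy _ (hx t ht)
      have hB : ∀ b ∈ A, b ≠ 0 → ∀ t ∈ T, t * b⁻¹ ∈ T := by
        intro b hb hb0 t ht
        have hinj : Function.Injective (ρ b) := fun x z hxz => mul_right_cancel₀ hb0 hxz
        have h4 : T.map (ρ b) ≤ T := by
          rintro _ ⟨x, hx, rfl⟩; exact hA b hb x hx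
        have h5 : T.map (ρ b) = T := Submodule.eq_of_le_of_finrank_le h4
          (LinearEquiv.finrank_eq (Submodule.equivMapOfInjective (ρ b) hinj T)).le
        rw [← h5] at ht
        obtain ⟨x, hx, rfl⟩ := ht
        show x * b * b⁻¹ ∈ T
        rwa [mul_assoc, mul_inv_cancel₀ hb0, mul_one]
      have hyT : y ∈ T := by
        have := hex 1 (Submodule.one_le.1 (one_le_pow_of_one_le' (Submodule.one_le.2 h1V) _))
        simpa using this
      have hall : ∀ q, q ∈ T := by
        intro q
        obtain ⟨a, ha, b, hb, hb0, he⟩ := hQuot (y⁻¹ * q)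
        have := hA a ha _ (hB b hb hb0 y hyT)
        rw [mul_assoc, ← he, ← mul_assoc, mul_inv_cancel₀ hy, one_mul] at this
        exact this
      apply hno
      refine ⟨Finset.univ.image fun a => y * u a, fun q => ?_⟩
      have hq := hall q
      have : T = Submodule.span E ((Finset.univ.image fun a => y * u a : Finset Q) : Set Q) := by
        rw [hT]; congr 1; simp
      rw [this, Submodule.mem_span_finset] at hq
      obtain ⟨f, _, hf⟩ := hq
      refine ⟨fun x => (f x : Q), fun x _ => (f x).2, ?_⟩
      rw [← hf]
      rfl
end Indep

section Count

lemma bd_sum_bound {k M : Type*} [Field k] [AddCommGroup M] [Module k M] {r : ℕ}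
    (φ : Fin r → Module.End k M) (U : Submodule k M) [FiniteDimensional k U] (B : ℕ)
    (h : ∀ i, Module.finrank k ↥(U ⊔ U.map (φ i)) ≤ B) :
    bd φ U + r * Module.finrank k U ≤ r * B := by
  classical
  have key : ∀ s : Finset (Fin r), ∃ P : Submodule k M, FiniteDimensional k P ∧ U ≤ P ∧
      (∀ i ∈ s, U.map (φ i) ≤ P) ∧
      Module.finrank k P + s.card * Module.finrank k U ≤ Module.finrank k U + s.card * B := by
    intro s
    induction s using Finset.induction_on with
    | empty => exact ⟨U, inferInstance, le_rfl, by simp, by simp⟩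
    | insert i s hi ih =>
      obtain ⟨P, fP, h1, h2, h3⟩ := ih
      refine ⟨P ⊔ (U ⊔ U.map (φ i)), inferInstance, h1.trans le_sup_left, ?_, ?_⟩
      · intro j hj
        rcases Finset.mem_insert.1 hj with rfl | hj
        · exact le_sup_right.trans le_sup_right
        · exact (h2 j hj).trans le_sup_left
      · have e1 := Submodule.finrank_sup_add_finrank_inf_eq P (U ⊔ U.map (φ i))
        have e2 : Module.finrank k U ≤ Module.finrank k ↥(P ⊓ (U ⊔ U.map (φ i))) :=
          Submodule.finrank_mono (le_inf h1 le_sup_left)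
        have e3 := h i
        rw [Finset.card_insert_of_notMem hi]
        linarith
  obtain ⟨P, fP, h1, h2, h3⟩ := key Finset.univ
  have e1 : nb φ U ≤ P := nb_le h1 fun i x hx => h2 i (Finset.mem_univ i) ⟨x, hx, rfl⟩
  have e2 := Submodule.finrank_mono e1
  have e3 := bd_add φ U
  rw [Finset.card_univ, Fintype.card_fin] at h3
  linarith

variable {F : Type*} [Field F] {R : Type*} [Ring R] [NoZeroDivisors R] [Nontrivial R] [Algebra F R]

lemma erode {r : ℕ} (w : Fin r → R) (t : ℕ → Fin r → F) (X : Submodule F R)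
    [FiniteDimensional F X] (k : ℕ) :
    ∃ Y : Submodule F R, Y ≤ X ∧ (∀ y ∈ Y, ∀ i ≤ k, gq w t i * y ∈ X) ∧
      Module.finrank F X ≤ Module.finrank F Y + k * bd (lm F w) X := by
  induction k with
  | zero =>
    refine ⟨X, le_rfl, fun y hy i hi => ?_, by simp⟩
    obtain rfl : i = 0 := by omega
    simpa [gq] using hy
  | succ k ih =>
    obtain ⟨Y, h1, h2, h3⟩ := ih
    have fY : FiniteDimensional F Y := Submodule.finiteDimensional_of_le h1
    let g : R →ₗ[F] R ⧸ X := X.mkQ.comp (LinearMap.mulLeft F (gq w t (k+1)))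
    have hg : ∀ x, x ∈ LinearMap.ker g ↔ gq w t (k+1) * x ∈ X := by
      intro x
      simp [g, LinearMap.mem_ker]
    refine ⟨Y ⊓ LinearMap.ker g, inf_le_left.trans h1, ?_, ?_⟩
    · rintro y ⟨hy1, hy2⟩ i hi
      rcases Nat.lt_or_ge k i with h | h
      · obtain rfl : i = k + 1 := by omega
        exact (hg y).1 hy2
      · exact h2 y hy1 i h
    · have e1 := finrank_map_add_ker g Y
      have e2 : Y.map g ≤ (nb (lm F w) X).map X.mkQ := by
        rintro _ ⟨y, hy, rfl⟩
        refine ⟨gq w t (k+1) * y, ?_, rfl⟩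
        rw [gq, gv, Finset.sum_mul, Finset.sum_mul]
        refine Submodule.sum_mem _ fun j _ => ?_
        rw [smul_mul_assoc, smul_mul_assoc, mul_assoc]
        exact Submodule.smul_mem _ _ (mem_nb (lm F w) j (h2 y hy k le_rfl))
      have e3 := finrank_map_add_ker X.mkQ (nb (lm F w) X)
      rw [Submodule.ker_mkQ, inf_eq_right.2 (le_nb _ _)] at e3
      have e4 := Submodule.finrank_mono e2
      have e5 := bd_add (lm F w) X
      have : (k+1) * bd (lm F w) X = k * bd (lm F w) X + bd (lm F w) X := by ring
      omega
end Count

section Main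
variable {K Q : Type*} [Field K] [DivisionRing Q] [Algebra K Q]

lemma count_one {r : ℕ} (w : Fin r → Q) (h1 : (1:Q) ∈ Submodule.span K (Set.range w))
    (hg : 1 < gkWrt K (Submodule.span K (Set.range w)))
    (hor : (∃ i0, Transcendental K (w i0)) ∨ ∀ x ∈ Algebra.adjoin K (Set.range w), IsAlgebraic K x)
    (D : Subring Q) (hDK : ∀ c : K, algebraMap K Q c ∈ D) (hw : ∀ j, w j ∈ D)
    (V : Submodule K Q) [FiniteDimensional K V]
    (hind : ∀ y : Q, y ≠ 0 → ∀ n, ∃ u : Fin (n+1) → Q, (∀ a, u a ∈ V ^ n) ∧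
      ∀ c : Fin (n+1) → Q, (∀ a, c a ∈ D) → ∑ a, c a * (y * u a) = 0 → c = 0)
    (n k : ℕ) (hk : k * bd (lm K w) (V ^ n) < Module.finrank K ↥(V ^ n)) :
    (n+1) * k ≤ bd (lm K w) (V ^ (2*n)) := by
  classical
  have fV := fun n => fd_pow V n
  let β := hBC (Gm r) K Q
  let F := HahnSeries (Gm r) K
  let W : Fin r → HahnSeries (Gm r) Q := fun i => β.C (w i)
  let t := tt K r
  have hL := hahn_words w h1 hg hor k
  have fX := β.fd_ext (V^n)
  have fX2 := β.fd_ext (V^(2*n))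
  obtain ⟨Y, hY1, hY2, hY3⟩ := erode W t (β.ext (V^n)) k
  rw [β.finrank_ext, show bd (lm F W) (β.ext (V^n)) = _ from β.bd_ext w (V^n)] at hY3
  have hYne : Y ≠ ⊥ := by
    rintro rfl
    rw [finrank_bot] at hY3
    omega
  obtain ⟨y, hyY, hy0⟩ := Submodule.exists_mem_ne_zero_of_ne_bot hYne
  obtain ⟨u, hu1, hu2⟩ := hind y.leadingCoeff (HahnSeries.leadingCoeff_ne_zero.2 hy0) n
  let DD := hD (K := K) (Gm r) D hDK
  let W' : Fin r → DD := fun i => ⟨W i, hD_C (hw i)⟩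
  have hq : ∀ i, gq W t i ∈ DD := by
    intro i
    induction i with
    | zero => exact one_mem DD
    | succ i ih =>
      rw [gq]
      refine mul_mem ?_ ih
      rw [gv]
      exact sum_mem fun j _ => DD.smul_mem (hD_C (hw j)) _
  let S : Set DD := {d | (d : HahnSeries (Gm r) Q) ∈ gq W t '' Set.Iic k}
  have hS : LamGe (lm F W') S k := by
    intro U fU sU
    have e1 := bd_map (φ := lm F W') (ψ := lm F W) DD.val.toLinearMap
      (by intro i x; simp [lm, W']) Subtype.val_injective U
    rw [← e1]
    refine hL _ inferInstance ?_
    rintro _ ⟨i, hi, rfl⟩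
    exact ⟨⟨gq W t i, hq i⟩, sU ⟨i, hi, rfl⟩, rfl⟩
  let f : Fin (n+1) → DD →ₗ[F] HahnSeries (Gm r) Q := fun a =>
    (LinearMap.mulRight F (y * β.C (u a))).comp DD.val.toLinearMap
  have hX : ∀ s ∈ S, ∀ a, f a s ∈ β.ext (V^(2*n)) := by
    rintro s ⟨i, hi, hs⟩ a
    show (s : HahnSeries (Gm r) Q) * (y * β.C (u a)) ∈ β.ext (V^(2*n))
    rw [← hs, ← mul_assoc]
    have h3 := hY2 y hyY i hi
    have h4 : β.ext (V^n) ≤ (β.ext (V^(2*n))).comap (LinearMap.mulRight F (β.C (u a))) := by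
      rw [BC.ext, Submodule.span_le]
      rintro _ ⟨x, hx, rfl⟩
      show β.C x * β.C (u a) ∈ β.ext (V^(2*n))
      rw [← map_mul]
      apply β.mem_ext
      rw [two_mul, pow_add]
      exact Submodule.mul_mem_mul hx (hu1 a)
    exact h4 h3
  have := line_lemma (φ := lm F W') (ψ := lm F W) f
    (by intro a i x; simp [f, lm, W', mul_assoc])
    (fun d hd => hD_inj u y hu2 d hd) hS (β.ext (V^(2*n))) hX
  rwa [show bd (lm F W) (β.ext (V^(2*n))) = _ from β.bd_ext w (V^(2*n))] at this

lemma count_two {r : ℕ} (w : Fin r → Q) (A : Subalgebra K Q) (V : Submodule K Q)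
    [FiniteDimensional K V] (h1V : (1 : Q) ∈ V)
    (hVA : Algebra.adjoin K (V : Set Q) = A)
    (hQuot : ∀ q : Q, ∃ a ∈ A, ∃ b ∈ A, b ≠ 0 ∧ q = b⁻¹ * a) :
    ∃ c, ∀ n, bd (lm K w) (V^n) + r * Module.finrank K ↥(V^n) ≤ r * Module.finrank K ↥(V^(n+c)) := by
  classical
  have fV := fun n => fd_pow V n
  choose a ha b hb hb0 he using fun i => hQuot (w i)
  have h2 : ∀ i, ∃ c, a i ∈ V^c ∧ b i ∈ V^c := by
    intro i
    obtain ⟨c1, hc1⟩ := mem_pow_of_adjoin h1V (by rw [hVA]; exact ha i)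
    obtain ⟨c2, hc2⟩ := mem_pow_of_adjoin h1V (by rw [hVA]; exact hb i)
    exact ⟨max c1 c2, pow_mono_sub h1V (le_max_left _ _) hc1, pow_mono_sub h1V (le_max_right _ _) hc2⟩
  choose c hca hcb using h2
  refine ⟨∑ i, c i, fun n => bd_sum_bound _ _ _ fun i => ?_⟩
  have hci : c i ≤ ∑ i, c i := Finset.single_le_sum (fun _ _ => Nat.zero_le _) (Finset.mem_univ i)
  have inj : Function.Injective (LinearMap.mulLeft K (b i)) :=
    fun x y hxy => mul_left_cancel₀ (hb0 i) hxy
  rw [← finrank_map_inj _ inj]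
  apply Submodule.finrank_mono
  rw [Submodule.map_le_iff_le_comap]
  have hmul : ∀ x ∈ V ^ (c i), ∀ z ∈ V^n, x * z ∈ V ^ (n + ∑ i, c i) := by
    intro x hx z hz
    rw [add_comm, pow_add]
    exact Submodule.mul_mem_mul (pow_mono_sub h1V hci hx) hz
  refine sup_le ?_ ?_
  · intro x hx
    exact hmul _ (hcb i) x hx
  · rintro _ ⟨x, hx, rfl⟩
    show b i * (w i * x) ∈ V ^ (n + ∑ i, c i)
    rw [← mul_assoc, he i, ← mul_assoc, mul_inv_cancel₀ (hb0 i), one_mul]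
    exact hmul _ (hca i) x hx

lemma exists_family (D : Subring Q) (hDK : ∀ c : K, algebraMap K Q c ∈ D)
    (hGKD : (2 : EReal) ≤ gkOfSet K (D : Set Q)) :
    ∃ (r : ℕ) (w : Fin r → Q), (∀ j, w j ∈ D) ∧ (1:Q) ∈ Submodule.span K (Set.range w) ∧
      1 < gkWrt K (Submodule.span K (Set.range w)) ∧
      ((∃ i0, Transcendental K (w i0)) ∨
        ∀ x ∈ Algebra.adjoin K (Set.range w), IsAlgebraic K x) := by
  classical
  have h12 : (1 : EReal) < 2 := by exact_mod_cast (by norm_num : (1:ℝ) < 2)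
  obtain ⟨_, ⟨W, fW, h1W, hWD, rfl⟩, hW⟩ := lt_sSup_iff.1 (h12.trans_le hGKD)
  let DA : Subalgebra K Q := { D with algebraMap_mem' := hDK }
  -- finite families spanning
  have fam : ∀ (W : Submodule K Q), FiniteDimensional K W → ∀ x ∈ W, ∃ (r : ℕ) (w : Fin r → Q),
      Submodule.span K (Set.range w) = W ∧ ∃ i0, w i0 = x := by
    intro W fW x hx
    obtain ⟨s, hs⟩ : W.FG := Module.Finite.iff_fg.1 fW
    let s' := insert x s
    let e := s'.equivFin.symm
    refine ⟨s'.card, fun i => (e i : Q), ?_, ⟨e.symm ⟨x, Finset.mem_insert_self _ _⟩, by simp⟩⟩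
    have : Set.range (fun i => (e i : Q)) = (s' : Set Q) := by
      ext z
      constructor
      · rintro ⟨i, rfl⟩; exact (e i).2
      · intro hz; exact ⟨e.symm ⟨z, hz⟩, by simp⟩
    rw [this, Finset.coe_insert, Submodule.span_insert_eq_span, hs]
    rw [hs]; exact hx
  have hpD : ∀ j, ∀ z ∈ W^j, z ∈ D := by
    intro j z hz
    have h2 : W ^ j ≤ Subalgebra.toSubmodule DA := by
      refine (pow_le_adjoin W j).trans ?_
      exact Algebra.adjoin_le (S := DA) hWD
    exact h2 hz
  by_cases hx : ∃ x ∈ Algebra.adjoin K (W : Set Q), Transcendental K x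
  · obtain ⟨x, hx, hxt⟩ := hx
    obtain ⟨j, hj⟩ := mem_pow_of_adjoin h1W hx
    have hj' := pow_mono_sub h1W (Nat.le_succ j) hj
    have hWj : W ≤ W ^ (j+1) := by
      have := pow_mono_sub h1W (show 1 ≤ j+1 by omega)
      rwa [pow_one] at this
    have fj := fd_pow W (j+1)
    obtain ⟨r, w, hw, i0, hi0⟩ := fam (W^(j+1)) fj x hj'
    refine ⟨r, w, fun i => hpD (j+1) _ ?_, ?_, ?_, Or.inl ⟨i0, by rw [hi0]; exact hxt⟩⟩
    · rw [← hw]; exact Submodule.subset_span ⟨i, rfl⟩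
    · rw [hw]; exact hWj h1W
    · rw [hw]; exact hW.trans_le (gk_mono hWj)
  · push Not at hx
    obtain ⟨r, w, hw, i0, hi0⟩ := fam W fW 1 h1W
    refine ⟨r, w, fun i => hWD ?_, ?_, ?_, Or.inr ?_⟩
    · rw [← hw]; exact Submodule.subset_span ⟨i, rfl⟩
    · rw [hw]; exact h1W
    · rw [hw]; exact hW
    · intro x h
      rw [← Algebra.adjoin_span, hw] at h
      have := hx x h
      rwa [Transcendental, not_not] at this

end Main

/-- Theorem 2 (main theorem) of the paper: if `A` is a finitely generated domain over `K`
of GK dimension `< 3`, with quotient division algebra `Q(A) = Q`, and `D` is a division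
subalgebra of `Q` of GK dimension at least `2`, then `Q` is finite-dimensional as a
left `D`-vector space. -/
theorem stmt8 {K Q : Type*} [Field K] [DivisionRing Q] [Algebra K Q]
    (A : Subalgebra K Q)
    -- `A` is finitely generated of GK dimension < 3, witnessed by a generating subspace:
    (V : Submodule K Q) (hVfin : FiniteDimensional K ↥V) (h1V : (1 : Q) ∈ V)
    (hVA : Algebra.adjoin K (V : Set Q) = A)
    (hGKA : gkWrt K V < 3)
    -- `Q` is the quotient division algebra of `A`:
    (hQuot : ∀ q : Q, ∃ a ∈ A, ∃ b ∈ A, b ≠ 0 ∧ q = b⁻¹ * a)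
    -- `D` is a division subalgebra of `Q`:
    (D : Subring Q) (hDK : ∀ c : K, algebraMap K Q c ∈ D)
    (hDinv : ∀ x ∈ D, x⁻¹ ∈ D)
    -- of GK dimension at least 2:
    (hGKD : (2 : EReal) ≤ gkOfSet K (D : Set Q)) :
    -- then `Q` is finite-dimensional as a left `D`-vector space:
    ∃ s : Finset Q, ∀ q : Q, ∃ c : Q → Q,
      (∀ x ∈ s, c x ∈ D) ∧ q = ∑ x ∈ s, c x * x := by
  classical
  by_contra hno
  obtain ⟨r, w, hw, h1, hg, hor⟩ := exists_family (K := K) D hDK hGKD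
  obtain ⟨c, hc⟩ := count_two w A V h1V hVA hQuot
  obtain ⟨α, hα, H3⟩ := gk_lt_three hGKA
  have fV := fun n => fd_pow V n
  have key := fun n k hk => count_one w h1 hg hor D hDK hw V
    (fun y hy n => left_indep A V h1V hVA hQuot D hDinv hno y hy n) n k hk
  have hv1 : ∀ n, 1 ≤ Module.finrank K ↥(V ^ n) := by
    intro n
    have hm : (1 : Q) ∈ V ^ n := pow_mono_sub h1V (Nat.zero_le n) (by simp [Submodule.mem_one])
    have : Nontrivial ↥(V ^ n) := ⟨⟨⟨1, hm⟩, 0, fun h => one_ne_zero (congrArg Subtype.val h)⟩⟩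
    exact Module.finrank_pos
  refine growth_contra (fun n => Module.finrank K ↥(V ^ n)) (fun n => bd (lm K w) (V ^ n))
    (fun m n h => Submodule.finrank_mono (pow_mono_sub h1V h)) hv1 r c ?_ hc α hα H3
  intro n
  have hk := key n
  have hvn := hv1 n
  show (n + 1) * Module.finrank K ↥(V ^ n)
    ≤ bd (lm K w) (V ^ n) * (bd (lm K w) (V ^ (2 * n)) + n + 1)
  generalize Module.finrank K ↥(V ^ n) = v at *
  generalize bd (lm K w) (V ^ n) = s at *
  generalize bd (lm K w) (V ^ (2 * n)) = s2 at *
  rcases Nat.eq_zero_or_pos s with h0 | hs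
  · have := hk (s2 + 1) (by rw [h0]; omega)
    nlinarith
  · have e1 := Nat.div_mul_le_self (v - 1) s
    have e2 := Nat.lt_div_mul_add (a := v - 1) hs
    have e3 := hk ((v - 1) / s) (by omega)
    generalize (v - 1) / s = k at *
    have e4 : v ≤ (k + 1) * s := by
      rw [add_mul, one_mul]; omega
    calc (n + 1) * v ≤ (n + 1) * ((k + 1) * s) := Nat.mul_le_mul_left _ e4
      _ = s * ((n + 1) * k + n + 1) := by ring
      _ ≤ s * (s2 + n + 1) := Nat.mul_le_mul_left _ (by omega)
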